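/- arXiv:math/0701788 — 3 statements merged into one kernel-verified Lean document; each statement's English description precedes it below -/
import Mathlib

section
/- Borel orbit equivalence relations pass to open subgroups: Let H be an open subgroup of G. Then the orbit equivalence relation E_G = {(x,y) ∈ X×X : ∃g ∈ G, g·x = y} induced on X by the G-action is a Borel subset of X×X if and only if the orbit equivalence relation E_H = {(x,y) ∈ X×X : ∃h ∈ H, h·x = y} induced by the H-action is a Borel subset of X×X. -/
open Set Pointwise

noncomputable section

/-- `S_∞`, the group of all permutations of `ℕ`. -/
abbrev Sinf : Type := Equiv.Perm ℕ

/-- The topology of pointwise convergence on `S_∞`. -/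
instance SinfTopology : TopologicalSpace Sinf :=
  TopologicalSpace.induced (fun g : Sinf => (g : ℕ → ℕ)) Pi.topologicalSpace

/-- The graph of the restriction of a permutation `g` to a finite set `d`. -/
def restr (g : Sinf) (d : Finset ℕ) : Set (ℕ × ℕ) := {p | p.1 ∈ d ∧ g p.1 = p.2}

/-- The domain of a partial map coded by its graph. -/
def pdom (σ : Set (ℕ × ℕ)) : Set ℕ := Prod.fst '' σ

/-- The range of a partial map coded by its graph. -/
def prng (σ : Set (ℕ × ℕ)) : Set ℕ := Prod.snd '' σ

/-- `S^G_{<∞}`: graphs of restrictions of elements of `G` to finite subsets of `ℕ`. -/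
def SGfin (G : Subgroup Sinf) : Set (Set (ℕ × ℕ)) :=
  {σ | ∃ g ∈ G, ∃ d : Finset ℕ, σ = restr g d}

/-- `V^G_σ`: the elements of `G` extending the partial bijection `σ`. -/
def Vb (G : Subgroup Sinf) (σ : Set (ℕ × ℕ)) : Set G :=
  {g : G | ∀ p ∈ σ, (g : Sinf) p.1 = p.2}

/-- `V^G_c`: the pointwise stabilizer of `c ⊆ ℕ` in `G`. -/
def Vc (G : Subgroup Sinf) (c : Set ℕ) : Set G :=
  {g : G | ∀ k ∈ c, (g : Sinf) k = k}

/-- The identity partial bijection on `c`. -/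
def idb (c : Set ℕ) : Set (ℕ × ℕ) := {p | p.1 ∈ c ∧ p.2 = p.1}

/-- The composition `σ ∘ f`, restricted to `f⁻¹[dom σ]`. -/
def compR (σ : Set (ℕ × ℕ)) (f : Sinf) : Set (ℕ × ℕ) := {p | (f p.1, p.2) ∈ σ}

/-- The composition `f ∘ σ`. -/
def compL (f : Sinf) (σ : Set (ℕ × ℕ)) : Set (ℕ × ℕ) := {p | (p.1, f⁻¹ p.2) ∈ σ}

/-- The Borel classes `Σ⁰_α(X)`: `Σ⁰_1(X)` consists of the open sets, and for `α > 1`,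
`Σ⁰_α(X)` consists of countable unions of sets whose complements lie in
`⋃_{1 ≤ β < α} Σ⁰_β(X)` (i.e. of sets from `⋃_{1 ≤ β < α} Π⁰_β(X)`). -/
def SigmaB (X : Type*) [TopologicalSpace X] (α : Ordinal.{0}) : Set (Set X) :=
  if α ≤ 1 then {s | IsOpen s}
  else {s | ∃ f : ℕ → Set X,
      (∀ n, ∃ β : {γ : Ordinal.{0} // γ < α}, 1 ≤ β.1 ∧ (f n)ᶜ ∈ SigmaB X β.1) ∧
      s = ⋃ n, f n}
termination_by α
decreasing_by exact β.2

/-- The Borel classes `Π⁰_α(X)`: complements of sets in `Σ⁰_α(X)`. -/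
def PiB (X : Type*) [TopologicalSpace X] (α : Ordinal.{0}) : Set (Set X) :=
  {s | sᶜ ∈ SigmaB X α}

section Action

variable (G : Subgroup Sinf) {X : Type*} [TopologicalSpace X] [MulAction G X]

/-- The image `S • x` of a point under a set of group elements. -/
def setOrb (S : Set G) (x : X) : Set X := (fun g : G => g • x) '' S

/-- The image `S • B` of a set under a set of group elements. -/
def setSmul (S : Set G) (B : Set X) : Set X := ⋃ g ∈ S, g • B

/-- The `1`-sets `B₁(x, σ)`. -/
def BsetOne (A : ℕ → Set X) (σ : Set (ℕ × ℕ)) (x : X) : Set X :=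
  (⋂ l, ⋂ (_ : (setOrb G (Vb G σ) x ∩ A l).Nonempty), setSmul G (Vc G (prng σ)) (A l)) ∩
    (⋂ l, ⋂ (_ : setOrb G (Vb G σ) x ∩ A l = ∅), (setSmul G (Vc G (prng σ)) (A l))ᶜ)

/-- The successor step of the recursion defining the `α`-sets. -/
def BsetSucc (prev : Set (ℕ × ℕ) → X → Set X) (σ : Set (ℕ × ℕ)) (x : X) : Set X :=
  (⋂ b : Finset ℕ, ⋂ (_ : pdom σ ⊆ ↑b),
      ⋃ σ' ∈ SGfin G, ⋃ (_ : σ ⊆ σ') (_ : pdom σ' = ↑b), prev σ' x) ∩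
    (⋂ a : Finset ℕ, ⋂ (_ : prng σ ⊆ ↑a),
      ⋃ σ' ∈ SGfin G, ⋃ (_ : σ ⊆ σ') (_ : prng σ' = ↑a), prev σ' x)

/-- The `α`-sets `B_α(x, σ)`, for `α ≥ 1` (the value at `α = 0` is junk). -/
def Bset (A : ℕ → Set X) (α : Ordinal.{0}) : Set (ℕ × ℕ) → X → Set X :=
  @Ordinal.limitRecOn (fun _ => Set (ℕ × ℕ) → X → Set X) α
    (fun _ _ => univ)
    (fun o ih => if o = 0 then BsetOne G A else BsetSucc G ih)
    (fun o _ ih σ x => ⋂ β : Ordinal.{0}, ⋂ (hβ : β < o), ⋂ (_ : 1 ≤ β), ih β hβ σ x)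

/-- The family `𝓑^x_{<α}` consisting of the basic open sets together with all
`β`-sets of `x` for `1 ≤ β < α`. -/
def BltFam (A : ℕ → Set X) (x : X) (α : Ordinal.{0}) : Set (Set X) :=
  {B | (∃ l, B = A l) ∨
    ∃ β : Ordinal.{0}, 1 ≤ β ∧ β < α ∧ ∃ σ ∈ SGfin G, B = Bset G A β σ x}

/-- `γ^G_*(x)`: the least countable ordinal `γ` such that for all `σ, δ ∈ S^G_{<∞}`
with equal ranges, if `B_α(x,σ) ≠ B_α(x,δ)` for some countable ordinal `α ≥ 1`,
then already `B_γ(x,σ) ≠ B_γ(x,δ)`. -/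
def gammaStar (A : ℕ → Set X) (x : X) : Ordinal :=
  sInf {γ : Ordinal.{0} | γ.card ≤ Cardinal.aleph0 ∧
    ∀ σ ∈ SGfin G, ∀ δ ∈ SGfin G, prng σ = prng δ →
      (∃ α : Ordinal.{0}, 1 ≤ α ∧ α.card ≤ Cardinal.aleph0 ∧
        Bset G A α σ x ≠ Bset G A α δ x) →
      Bset G A γ σ x ≠ Bset G A γ δ x}

end Action

/-- The topology on a subset `S ⊆ X` generated by the traces on `S` of the members
of the family `F`. -/
def traceTop {X : Type*} (S : Set X) (F : Set (Set X)) : TopologicalSpace S :=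
  TopologicalSpace.generateFrom {u : Set S | ∃ B ∈ F, u = Subtype.val ⁻¹' B}

/-- The space of closed subsets of `Y`. -/
def EffrosSpace (Y : Type*) [TopologicalSpace Y] := {K : Set Y // IsClosed K}

/-- The Effros Borel structure on the space of closed subsets of `Y`. -/
def effrosSigma (Y : Type*) [TopologicalSpace Y] : MeasurableSpace (EffrosSpace Y) :=
  MeasurableSpace.generateFrom
    {S | ∃ U : Set Y, IsOpen U ∧ S = {K : EffrosSpace Y | (K.1 ∩ U).Nonempty}}

open Filter Topology TopologicalSpace MeasureTheory

set_option linter.unusedSectionVars false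

section Vaught

/-- The Vaught transform. -/
def VQ {G Z : Type*} [TopologicalSpace G] [SMul G Z] (C : Set Z) (U : Set G) : Set Z :=
  {z | ¬ IsMeagre {g : G | g ∈ U ∧ g • z ∈ C}}

variable {G Z : Type*} [Group G] [TopologicalSpace G] [IsTopologicalGroup G] [PolishSpace G]
  [MulAction G Z]

theorem VQ_iUnion {ι κ : Type*} [Countable ι] [Countable κ] (C : ι → Set Z) (U : κ → Set G) :
    VQ (⋃ i, C i) (⋃ j, U j) = ⋃ i, ⋃ j, VQ (C i) (U j) := by
  ext z
  simp only [VQ, mem_ofPred_eq, mem_iUnion]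
  rw [← not_iff_not]
  push Not
  constructor
  · intro h i j
    refine h.mono ?_
    rintro g ⟨h1, h2⟩
    exact ⟨⟨j, h1⟩, ⟨i, h2⟩⟩
  · intro h
    refine (isMeagre_iUnion fun i => isMeagre_iUnion fun j => h i j).mono ?_
    rintro g ⟨⟨j, h1⟩, ⟨i, h2⟩⟩
    simp only [mem_iUnion]
    exact ⟨i, j, h1, h2⟩

theorem VQ_mono {C C' : Set Z} {U U' : Set G} (hC : C ⊆ C') (hU : U ⊆ U') :
    VQ C U ⊆ VQ C' U' := by
  intro z hz (h : IsMeagre _)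
  refine hz (h.mono ?_)
  rintro g ⟨h1, h2⟩
  exact ⟨hU h1, hC h2⟩

theorem smul_mem_VQ (C : Set Z) (U : Set G) (h : G) (z : Z) :
    h • z ∈ VQ C U ↔ z ∈ VQ C {g | g * h⁻¹ ∈ U} := by
  simp only [VQ, mem_ofPred_eq]
  rw [not_iff_not]
  constructor
  · intro hm
    have := hm.preimage_of_isOpenMap (Homeomorph.mulRight h⁻¹).continuous
      (Homeomorph.mulRight h⁻¹).isOpenMap
    refine this.mono ?_
    rintro g ⟨h1, h2⟩
    simp [h1, smul_smul, h2]
  · intro hm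
    have := hm.preimage_of_isOpenMap (Homeomorph.mulRight h).continuous
      (Homeomorph.mulRight h).isOpenMap
    refine this.mono ?_
    rintro g ⟨h1, h2⟩
    simp [h1, mul_smul, h2]

theorem VQ_univ (z : Z) : z ∈ VQ (G := G) (univ : Set Z) univ := by
  have := not_isMeagre_of_isOpen (X := G) isOpen_univ ⟨1, trivial⟩
  simpa [VQ] using this

theorem mem_VQ_of_isOpen [TopologicalSpace Z] [ContinuousSMul G Z] {C : Set Z} {U : Set G}
    (hC : IsOpen C) (hU : IsOpen U) (z : Z) : z ∈ VQ C U ↔ ∃ g ∈ U, g • z ∈ C := by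
  constructor
  · intro h
    obtain ⟨g, hg⟩ := nonempty_of_not_isMeagre h
    exact ⟨g, hg.1, hg.2⟩
  · rintro ⟨g, hg1, hg2⟩
    refine not_isMeagre_of_isOpen (hU.inter (hC.preimage (f := fun g : G => g • z) (by fun_prop)))
      ⟨g, hg1, hg2⟩

theorem measurable_VQ [TopologicalSpace Z] [ContinuousSMul G Z] [MeasurableSpace Z] [BorelSpace Z]
    {A : Set Z} (hA : MeasurableSet A) :
    ∀ U : Set G, IsOpen U → MeasurableSet (VQ A U) := by
  induction A, hA using MeasurableSet.induction_on_open with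
  | isOpen C hC =>
    intro U hU
    apply IsOpen.measurableSet
    have : VQ C U = ⋃ g ∈ U, {z | g • z ∈ C} := by
      ext z
      simp [mem_VQ_of_isOpen hC hU z]
    rw [this]
    exact isOpen_biUnion fun g _ => hC.preimage (continuous_const_smul g)
  | iUnion f _ _ ih =>
    intro U hU
    have := VQ_iUnion (G := G) f (fun _ : Unit => U)
    rw [iUnion_const] at this
    rw [this]
    exact .iUnion fun i => .iUnion fun _ => ih i U hU
  | compl A hA ih =>
    intro U hU
    have key : VQ Aᶜ U = ⋃ W ∈ {W ∈ countableBasis G | W ⊆ U}, (VQ A W)ᶜ := by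
      ext z
      simp only [mem_iUnion, mem_compl_iff, exists_prop, mem_ofPred_eq]
      constructor
      · intro hz
        borelize G
        have hs : MeasurableSet {g : G | g • z ∈ A}ᶜ :=
          (hA.preimage (f := fun g : G => g • z)
            (Continuous.measurable (by fun_prop))).compl
        obtain ⟨O, hO, hsO⟩ := hs.residualEq_isOpen
        have hne : (U ∩ O).Nonempty := by
          by_contra hemp
          rw [not_nonempty_iff_eq_empty] at hemp
          apply hz
          refine mem_of_superset hsO ?_
          rintro g hg ⟨h1, h2⟩
          have hg' : (g ∈ {g : G | g • z ∈ A}ᶜ) = (g ∈ O) := hg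
          have : g ∈ U ∩ O := ⟨h1, hg' ▸ h2⟩
          simp [hemp] at this
        obtain ⟨g, hg⟩ := hne
        obtain ⟨W, hW, hgW, hWU⟩ :=
          (isBasis_countableBasis G).exists_subset_of_mem_open hg (hU.inter hO)
        refine ⟨W, ⟨hW, fun x hx => (hWU hx).1⟩, ?_⟩
        simp only [VQ, mem_ofPred_eq, not_not]
        refine mem_of_superset hsO ?_
        rintro g hg ⟨h1, h2⟩
        have hg' : (g ∈ {g : G | g • z ∈ A}ᶜ) = (g ∈ O) := hg
        have : g ∈ {g : G | g • z ∈ A}ᶜ := hg' ▸ (hWU h1).2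
        exact this h2
      · rintro ⟨W, ⟨hW, hWU⟩, hz⟩ hm
        simp only [VQ, mem_ofPred_eq, not_not] at hz
        refine not_isMeagre_of_isOpen (isOpen_of_mem_countableBasis hW)
          (nonempty_of_mem_countableBasis hW) ((hz.union hm).mono ?_)
        intro g hg
        by_cases h : g • z ∈ A
        · exact Or.inl ⟨hg, h⟩
        · exact Or.inr ⟨hWU hg, h⟩
    rw [key]
    refine .biUnion ((countable_countableBasis G).mono fun x hx => hx.1) fun W hW => ?_
    exact (ih W (isOpen_of_mem_countableBasis hW.1)).compl


theorem isOpen_VQ_of_basis {t t' : TopologicalSpace Z} {b : Set (Set Z)}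
    (hb : @IsTopologicalBasis Z t b) (hbc : b.Countable)
    (h : ∀ C ∈ b, ∀ U ∈ countableBasis G, IsOpen[t'] (VQ C U))
    (C : Set Z) (hC : IsOpen[t] C) (U : Set G) (hU : IsOpen U) : IsOpen[t'] (VQ C U) := by
  obtain ⟨S, hSb, rfl⟩ := @IsTopologicalBasis.open_eq_sUnion Z t b hb C hC
  obtain ⟨T, hTb, rfl⟩ := (isBasis_countableBasis G).open_eq_sUnion hU
  have := (hbc.mono hSb).to_subtype
  have := ((countable_countableBasis G).mono hTb).to_subtype
  rw [sUnion_eq_iUnion, sUnion_eq_iUnion, VQ_iUnion]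
  exact isOpen_iUnion fun i => isOpen_iUnion fun j => h _ (hSb i.2) _ (hTb j.2)

theorem exists_step (t : TopologicalSpace Z) (ht : @PolishSpace Z t)
    [σ : TopologicalSpace Z] [PolishSpace Z] [ContinuousSMul G Z] (htσ : t ≤ σ) :
    ∃ t' : TopologicalSpace Z, t' ≤ t ∧ @PolishSpace Z t' ∧
      ∀ C : Set Z, IsOpen[t] C → ∀ U : Set G, IsOpen U → IsOpen[t'] (VQ C U) := by
  have hsc : @SecondCountableTopology Z t := @PolishSpace.toSecondCountableTopology Z t ht
  have hb := @isBasis_countableBasis Z t hsc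
  have hbc := @countable_countableBasis Z t hsc
  have hborel : @borel Z t = @borel Z σ := borel_eq_borel_of_le ht inferInstance htσ
  have hm : ∀ i : (@countableBasis Z t hsc) × (countableBasis G),
      @PolishSpace.IsClopenable Z t (VQ i.1.1 i.2.1) := by
    intro i
    have hC : IsOpen[t] i.1.1 := @IsTopologicalBasis.isOpen Z t _ _ hb i.1.2
    have hC' : @MeasurableSet Z (@borel Z t) i.1.1 := MeasurableSpace.measurableSet_generateFrom hC
    rw [hborel] at hC'
    have hQ : @MeasurableSet Z (@borel Z σ) (VQ i.1.1 i.2.1) := by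
      exact @measurable_VQ G Z _ _ _ _ _ σ _ (@borel Z σ) (@BorelSpace.mk Z σ (@borel Z σ) rfl)
        _ hC' _ (isOpen_of_mem_countableBasis i.2.2)
    rw [← hborel] at hQ
    exact @MeasurableSet.isClopenable Z t ht (@borel Z t) (@BorelSpace.mk Z t (@borel Z t) rfl) _ hQ
  choose m hmt hmp _ hmo using hm
  have : Countable (@countableBasis Z t hsc) := hbc.to_subtype
  have : Countable (countableBasis G) := (countable_countableBasis G).to_subtype
  obtain ⟨t', ht'm, ht't, ht'p⟩ := @PolishSpace.exists_polishSpace_forall_le Z _ _ t ht m hmt hmp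
  refine ⟨t', ht't, ht'p, ?_⟩
  exact isOpen_VQ_of_basis hb hbc fun C hC U hU => ht'm ⟨⟨C, hC⟩, ⟨U, hU⟩⟩ _ (hmo _)

theorem exists_top [σ : TopologicalSpace Z] [PolishSpace Z] [ContinuousSMul G Z]
    {Y : Set Z} (hY : @MeasurableSet Z (borel Z) Y) :
    ∃ t : TopologicalSpace Z, t ≤ σ ∧ @PolishSpace Z t ∧ IsClosed[t] Y ∧
      ∀ C : Set Z, IsOpen[t] C → ∀ U : Set G, IsOpen U → IsOpen[t] (VQ C U) := by
  let T := {t : TopologicalSpace Z // t ≤ σ ∧ @PolishSpace Z t}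
  have hstep : ∀ t : T, ∃ t' : T, t'.1 ≤ t.1 ∧
      ∀ C : Set Z, IsOpen[t.1] C → ∀ U : Set G, IsOpen U → IsOpen[t'.1] (VQ C U) := by
    intro t
    obtain ⟨t', h1, h2, h3⟩ := exists_step (G := G) t.1 t.2.2 t.2.1
    exact ⟨⟨t', h1.trans t.2.1, h2⟩, h1, h3⟩
  choose f hf1 hf2 using hstep
  obtain ⟨t0, ht0, ht0p, ht0c, -⟩ :=
    @MeasurableSet.isClopenable Z σ _ (borel Z) (@BorelSpace.mk Z σ (borel Z) rfl) _ hY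
  let s : ℕ → T := fun n => f^[n] ⟨t0, ht0, ht0p⟩
  have hs : ∀ n, s (n + 1) = f (s n) := fun n => Function.iterate_succ_apply' f n _
  have hanti : Antitone fun n => (s n).1 := antitone_nat_of_succ_le fun n => by
    rw [hs]; exact hf1 _
  have hle : ∀ n, (⨅ n, (s n).1) ≤ (s n).1 := fun n => iInf_le _ n
  refine ⟨⨅ n, (s n).1, (hle 0).trans (s 0).2.1,
    .iInf ⟨0, fun i => hanti (Nat.zero_le i)⟩ fun i => (s i).2.2, ?_, ?_⟩
  · exact IsClosed.mono ht0c (hle 0)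
  · intro C hC U hU
    -- C is a countable union of sets open in some stage
    have hb : C = ⋃ n, ⋃₀ {O | IsOpen[(s n).1] O ∧ O ⊆ C} := by
      apply Subset.antisymm
      · intro z hz
        have h1 : C ∈ @nhds Z (⨅ n, (s n).1) z := @IsOpen.mem_nhds Z (⨅ n, (s n).1) z C hC hz
        rw [nhds_iInf] at h1
        rw [mem_iInf_of_directed] at h1
        · obtain ⟨n, hn⟩ := h1
          obtain ⟨O, hOC, hO, hzO⟩ := (@mem_nhds_iff Z (s n).1 z C).1 hn
          exact mem_iUnion.2 ⟨n, O, ⟨hO, hOC⟩, hzO⟩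
        · have : Antitone fun n => @nhds Z (s n).1 z := fun a b hab => nhds_mono (hanti hab)
          exact this.directed_ge
      · exact iUnion_subset fun n => sUnion_subset fun O hO => hO.2
    rw [hb]
    have := VQ_iUnion (G := G) (fun n => ⋃₀ {O | IsOpen[(s n).1] O ∧ O ⊆ C}) (fun _ : Unit => U)
    rw [iUnion_const] at this
    rw [this]
    refine @isOpen_iUnion Z _ (⨅ n, (s n).1) _ fun n => @isOpen_iUnion Z _ (⨅ n, (s n).1) _ fun _ => ?_
    apply hle (n + 1)
    rw [hs]
    exact hf2 _ _ (@isOpen_sUnion Z (s n).1 _ fun O hO => hO.1) U hU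

/-- The Becker-Kechris topology. -/
@[reducible] def tauTop (G : Type*) {Z : Type*} [TopologicalSpace G] [SMul G Z] (t : TopologicalSpace Z) :
    TopologicalSpace Z :=
  generateFrom {S | ∃ C : Set Z, ∃ U : Set G, IsOpen[t] C ∧ IsOpen U ∧ S = VQ C U}

theorem isOpen_tau {t : TopologicalSpace Z} {C : Set Z} {U : Set G} (hC : IsOpen[t] C)
    (hU : IsOpen U) : IsOpen[tauTop G t] (VQ C U) :=
  isOpen_generateFrom_of_mem ⟨C, U, hC, hU, rfl⟩

theorem tau_ge {t : TopologicalSpace Z}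
    (h : ∀ C : Set Z, IsOpen[t] C → ∀ U : Set G, IsOpen U → IsOpen[t] (VQ C U)) :
    t ≤ tauTop G t := by
  refine le_generateFrom ?_
  rintro _ ⟨C, U, hC, hU, rfl⟩
  exact h C hC U hU

theorem tau_secondCountable {t : TopologicalSpace Z} (ht : @PolishSpace Z t) :
    @SecondCountableTopology Z (tauTop G t) := by
  have hsc : @SecondCountableTopology Z t := @PolishSpace.toSecondCountableTopology Z t ht
  have hb := @isBasis_countableBasis Z t hsc
  have hbc := @countable_countableBasis Z t hsc
  let F : Set (Set Z) := image2 (fun C (U : Set G) => VQ C U) (@countableBasis Z t hsc) (countableBasis G)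
  have hF : F.Countable := hbc.image2 (countable_countableBasis G) _
  refine @SecondCountableTopology.mk Z (tauTop G t) ⟨F, hF, ?_⟩
  apply le_antisymm
  · refine le_generateFrom ?_
    rintro _ ⟨C, hC, U, hU, rfl⟩
    exact isOpen_tau (@IsTopologicalBasis.isOpen Z t _ _ hb hC) (isOpen_of_mem_countableBasis hU)
  · refine le_generateFrom ?_
    rintro _ ⟨C, U, hC, hU, rfl⟩
    refine isOpen_VQ_of_basis hb hbc ?_ C hC U hU
    intro C hC U hU
    exact isOpen_generateFrom_of_mem ⟨C, hC, U, hU, rfl⟩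

theorem tau_smul {t : TopologicalSpace Z} (g : G) {O : Set Z} (hO : IsOpen[tauTop G t] O) :
    IsOpen[tauTop G t] {z | g • z ∈ O} := by
  suffices @Continuous Z Z (tauTop G t) (tauTop G t) (fun z => g • z) from
    @Continuous.isOpen_preimage Z Z (tauTop G t) (tauTop G t) _ this O hO
  refine continuous_generateFrom_iff.2 ?_
  rintro _ ⟨C, U, hC, hU, rfl⟩
  have : (fun z => g • z) ⁻¹' VQ C U = VQ C {x | x * g⁻¹ ∈ U} := by
    ext z; exact smul_mem_VQ C U g z
  rw [this]
  exact isOpen_tau hC (hU.preimage (continuous_mul_const g⁻¹))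

theorem tau_le {t : TopologicalSpace Z} [σ : TopologicalSpace Z] [ContinuousSMul G Z]
    (ht : t ≤ σ) : tauTop G t ≤ σ := by
  intro O hO
  rw [@isOpen_iff_forall_mem_open Z (tauTop G t)]
  intro z hz
  have hc : Continuous fun p : G × Z => p.1⁻¹ • p.2 := by fun_prop
  have h1 : (fun p : G × Z => p.1⁻¹ • p.2) ⁻¹' O ∈ 𝓝 ((1 : G), z) :=
    (hO.preimage hc).mem_nhds (by simpa using hz)
  obtain ⟨W, B, hW, h1W, hB, hzB, hWB⟩ := mem_nhds_prod_iff'.1 h1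
  refine ⟨VQ B W, ?_, isOpen_tau (ht B hB) hW, (mem_VQ_of_isOpen hB hW z).2 ⟨1, h1W, by simpa⟩⟩
  intro z' hz'
  obtain ⟨g, hg, hg'⟩ := (mem_VQ_of_isOpen hB hW z').1 hz'
  have : ((g, g • z') : G × Z) ∈ W ×ˢ B := ⟨hg, hg'⟩
  simpa using hWB this


theorem exists_subgroup_basis (hna : ∀ U ∈ 𝓝 (1 : G), ∃ V : Subgroup G, IsOpen (V : Set G) ∧ (V : Set G) ⊆ U) :
    ∃ V : ℕ → Subgroup G, (∀ n, IsOpen (V n : Set G)) ∧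
      ∀ U ∈ 𝓝 (1 : G), ∃ N, ∀ n ≥ N, (V n : Set G) ⊆ U := by
  obtain ⟨b, hb⟩ := (𝓝 (1 : G)).exists_antitone_basis
  choose V hV hVb using fun n => hna (b n) (hb.1.mem_of_mem trivial)
  refine ⟨V, hV, fun U hU => ?_⟩
  obtain ⟨N, -, hN⟩ := hb.1.mem_iff.1 hU
  exact ⟨N, fun n hn => (hVb n).trans ((hb.2 hn).trans hN)⟩

theorem continuous_inv_smul_tau
    (hna : ∀ U ∈ 𝓝 (1 : G), ∃ V : Subgroup G, IsOpen (V : Set G) ∧ (V : Set G) ⊆ U)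
    [t : TopologicalSpace Z]
    (hQ : ∀ C : Set Z, IsOpen C → ∀ U : Set G, IsOpen U → IsOpen (VQ C U)) :
    @Continuous (G × Z) Z _ (tauTop G t) (fun p => p.1⁻¹ • p.2) := by
  obtain ⟨V, hV, hVb⟩ := exists_subgroup_basis hna
  refine continuous_generateFrom_iff.2 ?_
  rintro _ ⟨C, U, hC, hU, rfl⟩
  rw [isOpen_prod_iff]
  intro g0 w0 h0
  have h1 : w0 ∈ VQ C {u | u * g0 ∈ U} := by
    have := (smul_mem_VQ C U g0⁻¹ w0).1 h0
    simpa using this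
  let A : ℕ → Set G := fun n => {u | ∀ v ∈ V n, u * v * g0 ∈ U}
  have hA : {u | u * g0 ∈ U} = ⋃ n, A n := by
    ext u
    simp only [mem_iUnion]
    constructor
    · intro hu
      have : {v | u * v * g0 ∈ U} ∈ 𝓝 (1 : G) :=
        (hU.preimage (f := fun v => u * v * g0) (by fun_prop)).mem_nhds (by simpa using hu)
      obtain ⟨N, hN⟩ := hVb _ this
      exact ⟨N, fun v hv => hN N le_rfl hv⟩
    · rintro ⟨n, hn⟩
      simpa using hn 1 (V n).one_mem
  have hAo : ∀ n, IsOpen (A n) := by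
    intro n
    rw [isOpen_iff_forall_mem_open]
    intro u hu
    refine ⟨{x | u⁻¹ * x ∈ V n}, ?_, (hV n).preimage (continuous_const_mul u⁻¹), by simp⟩
    intro x hx v hv
    have := hu (u⁻¹ * x * v) ((V n).mul_mem hx hv)
    simpa [mul_assoc] using this
  rw [hA] at h1
  have := VQ_iUnion (G := G) (fun _ : Unit => C) A
  rw [iUnion_const] at this
  rw [this] at h1
  simp only [mem_iUnion] at h1
  obtain ⟨-, n, hn⟩ := h1
  refine ⟨{g | g * g0⁻¹ ∈ V n}, VQ C (A n), (hV n).preimage (continuous_mul_const g0⁻¹),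
    hQ _ hC _ (hAo n), by simp, hn, ?_⟩
  rintro ⟨g, w⟩ ⟨hg, hw⟩
  change g⁻¹ • w ∈ VQ C U
  rw [smul_mem_VQ]
  refine VQ_mono subset_rfl ?_ hw
  intro u hu
  have := hu _ hg
  simpa [mul_assoc] using this

/-- `y` is in the `τ`-closure of `V • z`. -/
def InCl (τ : TopologicalSpace Z) (V : Subgroup G) (z y : Z) : Prop :=
  ∀ O : Set Z, IsOpen[τ] O → y ∈ O → ∃ v ∈ V, v • z ∈ O

theorem orbit_closure_nhd
    (hna : ∀ U ∈ 𝓝 (1 : G), ∃ V : Subgroup G, IsOpen (V : Set G) ∧ (V : Set G) ⊆ U)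
    [t : TopologicalSpace Z] [PolishSpace Z]
    (hQ : ∀ C : Set Z, IsOpen C → ∀ U : Set G, IsOpen U → IsOpen (VQ C U))
    (X : Set Z) (hX : IsClosed X) (z : Z) (hzX : ∀ y, y ∈ X ↔ ∃ g : G, g • z = y)
    (V : Subgroup G) (hV : IsOpen (V : Set G)) :
    ∃ O : Set Z, IsOpen[tauTop G t] O ∧ z ∈ O ∧ ∀ y ∈ O, y ∈ X → InCl (tauTop G t) V z y := by
  have hXg : ∀ y ∈ X, ∀ g : G, g • y ∈ X := by
    intro y hy g
    obtain ⟨k, rfl⟩ := (hzX y).1 hy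
    exact (hzX _).2 ⟨g * k, mul_smul g k z⟩
  let Bad : Set (Set G × Set Z) :=
    {q | q.1 ∈ countableBasis G ∧ q.2 ∈ countableBasis Z ∧ VQ q.2 q.1 ∩ X = ∅}
  have hBadc : Bad.Countable :=
    ((countable_countableBasis G).prod (countable_countableBasis Z)).mono
      fun q hq => mk_mem_prod hq.1 hq.2.1
  let S : Set (G × Z) := {p | p.2 ∈ X ∧ p ∉ ⋃ q ∈ Bad, q.1 ×ˢ q.2}
  have hSc : IsClosed S := by
    refine (hX.preimage continuous_snd).inter (IsOpen.isClosed_compl ?_)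
    exact isOpen_biUnion fun q hq => (isOpen_of_mem_countableBasis hq.1).prod
      (isOpen_of_mem_countableBasis hq.2.1)
  have hS1 : ∀ (B : Set Z) (W : Set G), ∀ y ∈ X, y ∈ VQ B W →
      ∃ w ∈ W, w • y ∈ B ∧ (w, w • y) ∈ S := by
    intro B W y hy hyQ
    by_contra hcon
    push Not at hcon
    apply hyQ
    refine (isMeagre_biUnion (f := fun q : Set G × Set Z => {g : G | g ∈ q.1 ∧ g • y ∈ q.2})
      hBadc ?_).mono ?_
    · intro q hq
      by_contra hm
      have : y ∈ VQ q.2 q.1 ∩ X := ⟨hm, hy⟩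
      rw [hq.2.2] at this
      exact this
    · rintro g ⟨hg1, hg2⟩
      have h1 := hcon g hg1 hg2
      have h2 : (g, g • y) ∈ ⋃ q ∈ Bad, q.1 ×ˢ q.2 := by
        by_contra h3
        exact h1 ⟨hXg y hy g, h3⟩
      simp only [mem_iUnion] at h2 ⊢
      obtain ⟨q, hq, h4⟩ := h2
      exact ⟨q, hq, h4.1, h4.2⟩
  have hzX' : z ∈ X := (hzX z).2 ⟨1, one_smul G z⟩
  have : PolishSpace S := hSc.polishSpace
  obtain ⟨w, -, -, hw⟩ := hS1 univ univ z hzX' (VQ_univ z)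
  have : Nonempty S := ⟨⟨_, hw⟩⟩
  have hf : @Continuous S Z _ (tauTop G t) (fun p => p.1.1⁻¹ • p.1.2) :=
    @Continuous.comp S (G × Z) Z _ _ (tauTop G t) _ _ (continuous_inv_smul_tau hna hQ)
      continuous_subtype_val
  let N : ℕ → Set Z := fun n => @closure Z (tauTop G t) {y | ∃ v ∈ V, denseSeq G n • v • z = y}
  have hN : ∀ n, @IsClosed Z (tauTop G t) (N n) := fun n => @isClosed_closure Z (tauTop G t) _
  have hcov : (⋃ n, (fun p : S => p.1.1⁻¹ • p.1.2) ⁻¹' (N n)) = univ := by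
    rw [eq_univ_iff_forall]
    rintro ⟨⟨g, y⟩, hp⟩
    obtain ⟨k, hk⟩ := (hzX _).1 (hXg y hp.1 g⁻¹)
    obtain ⟨n, hn⟩ := (denseRange_denseSeq G).exists_mem_open
      (hV.preimage (f := fun u => k⁻¹ * u) (by fun_prop)) ⟨k, by simp⟩
    refine mem_iUnion.2 ⟨n, @subset_closure Z (tauTop G t) _ _ ?_⟩
    refine ⟨(k⁻¹ * denseSeq G n)⁻¹, V.inv_mem hn, ?_⟩
    rw [smul_smul, mul_inv_rev, inv_inv, mul_inv_cancel_left, hk]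
  obtain ⟨n, ⟨⟨g0, w0⟩, hp⟩, hint⟩ := nonempty_interior_of_iUnion_of_closed
    (fun n => @IsClosed.preimage S Z _ (tauTop G t) _ hf _ (hN n)) hcov
  rw [mem_interior] at hint
  obtain ⟨T, hTN, hT, hpT⟩ := hint
  obtain ⟨T', hT', rfl⟩ := isOpen_induced_iff.1 hT
  obtain ⟨W, B, hW, hB, hgW, hwB, hWB⟩ := isOpen_prod_iff.1 hT' g0 w0 hpT
  have hsub : ∀ y ∈ X, y ∈ VQ B W → y ∈ N n := by
    intro y hy hyQ
    obtain ⟨w, hwW, hwB, hwS⟩ := hS1 B W y hy hyQ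
    have := hTN (a := ⟨(w, w • y), hwS⟩) (hWB ⟨hwW, hwB⟩)
    simpa using this
  have hne : ∃ y ∈ X, y ∈ VQ B W := by
    by_contra hcon
    push Not at hcon
    obtain ⟨W', hW'b, hgW', hW'⟩ := (isBasis_countableBasis G).exists_subset_of_mem_open hgW hW
    obtain ⟨B', hB'b, hgB', hB'⟩ := (isBasis_countableBasis Z).exists_subset_of_mem_open hwB hB
    refine hp.2 (mem_biUnion (x := (W', B')) ⟨hW'b, hB'b, ?_⟩ ⟨hgW', hgB'⟩)
    rw [eq_empty_iff_forall_notMem]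
    rintro y ⟨h1, h2⟩
    exact hcon y h2 (VQ_mono hB' hW' h1)
  have hQo : IsOpen[tauTop G t] (VQ B W) := isOpen_tau hB hW
  obtain ⟨y, hyX, hyQ⟩ := hne
  obtain ⟨-, hq, v, hv, rfl⟩ := (@mem_closure_iff Z (tauTop G t) _ _).1 (hsub y hyX hyQ) _ hQo hyQ
  set d := denseSeq G n with hd
  refine ⟨{y | (d * v) • y ∈ VQ B W}, tau_smul _ hQo, ?_, ?_⟩
  · change (d * v) • z ∈ VQ B W
    rwa [mul_smul]
  · intro y hy hyX O hO hyO
    have h1 := hsub _ (hXg y hyX (d * v)) hy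
    obtain ⟨-, hq', v', hv', rfl⟩ := (@mem_closure_iff Z (tauTop G t) _ _).1 h1
      {y | (d * v)⁻¹ • y ∈ O} (tau_smul _ hO) (by
        change (d * v)⁻¹ • (d * v) • y ∈ O
        rwa [inv_smul_smul])
    refine ⟨v⁻¹ * v', V.mul_mem (V.inv_mem hv) hv', ?_⟩
    have hq2 : (d * v)⁻¹ • d • v' • z ∈ O := hq'
    rw [smul_smul, smul_smul] at hq2
    convert hq2 using 2
    group


theorem back_forth
    (hna : ∀ U ∈ 𝓝 (1 : G), ∃ V : Subgroup G, IsOpen (V : Set G) ∧ (V : Set G) ⊆ U)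
    (τ : TopologicalSpace Z) [σ : TopologicalSpace Z] [T2Space Z] [ContinuousSMul G Z]
    (hτσ : τ ≤ σ) (X : Set Z) (hXg : ∀ y ∈ X, ∀ g : G, g • y ∈ X)
    (hnhd : ∀ y ∈ X, ∀ V : Subgroup G, IsOpen (V : Set G) →
      ∃ O : Set Z, IsOpen[τ] O ∧ y ∈ O ∧ ∀ y' ∈ O, y' ∈ X → InCl τ V y y')
    (H : Subgroup G) (hH : IsOpen (H : Set G)) (z z' : Z) (hz : z ∈ X) (hz' : z' ∈ X)
    (hcl : InCl τ H z' z) : ∃ h ∈ H, h • z = z' := by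
  obtain ⟨V, hV, hVb⟩ := exists_subgroup_basis hna
  let := upgradeIsCompletelyMetrizable G
  have hP : ∀ (n : ℕ) (a : G), ∃ P : Subgroup G, IsOpen (P : Set G) ∧ (P : Set G) ⊆ H ∧
      (P : Set G) ⊆ V n ∧ ∀ p ∈ P, dist a (p * a) ≤ 1 * (1 / 2) ^ n := by
    intro n a
    have h1 : {p : G | dist a (p * a) < 1 * (1 / 2) ^ n} ∈ 𝓝 (1 : G) := by
      refine (isOpen_lt (by fun_prop) continuous_const).mem_nhds ?_
      change dist a (1 * a) < 1 * (1 / 2) ^ n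
      rw [one_mul, dist_self]
      positivity
    obtain ⟨P, hPo, hPs⟩ := hna _ (inter_mem (inter_mem (hH.mem_nhds H.one_mem)
      ((hV n).mem_nhds (V n).one_mem)) h1)
    exact ⟨P, hPo, fun x hx => (hPs hx).1.1, fun x hx => (hPs hx).1.2,
      fun p hp => le_of_lt (hPs hp).2⟩
  choose P hPo hPH hPV hPd using hP
  let J : ℕ → G × G → Prop := fun n s =>
    s.1 ∈ H ∧ s.2 ∈ H ∧ InCl τ (P n s.1) (s.1 • z) (s.2 • z')
  have hbase : ∃ s, J 0 s := by
    obtain ⟨O, hO, hzO, hOc⟩ := hnhd z hz (P 0 1) (hPo 0 1)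
    obtain ⟨h, hh, hhO⟩ := hcl O hO hzO
    refine ⟨(1, h), H.one_mem, hh, ?_⟩
    simpa using hOc _ hhO (hXg _ hz' h)
  have hstep : ∀ (n : ℕ) (s : {s // J n s}), ∃ s' : {s // J (n + 1) s},
      (∃ p ∈ P n s.1.1, s'.1.1 = p * s.1.1) ∧ (∃ p ∈ P n s.1.2, s'.1.2 = p * s.1.2) := by
    rintro n ⟨⟨a, b⟩, ha, hb, hab⟩
    obtain ⟨O, hO, hbO, hOc⟩ := hnhd (b • z') (hXg _ hz' b) (P n b) (hPo n b)
    obtain ⟨p, hp, hpO⟩ := hab O hO hbO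
    have h1 := hOc _ hpO (hXg _ (hXg _ hz a) p)
    obtain ⟨O', hO', haO', hOc'⟩ := hnhd (p • a • z) (hXg _ (hXg _ hz a) p) (P (n + 1) (p * a))
      (hPo _ _)
    obtain ⟨q, hq, hqO'⟩ := h1 O' hO' haO'
    have h2 := hOc' _ hqO' (hXg _ (hXg _ hz' b) q)
    refine ⟨⟨(p * a, q * b), H.mul_mem (hPH _ _ hp) ha, H.mul_mem (hPH _ _ hq) hb, ?_⟩,
      ⟨p, hp, rfl⟩, ⟨q, hq, rfl⟩⟩
    simpa [mul_smul] using h2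
  choose f hf1 hf2 using hstep
  obtain ⟨s0, hs0⟩ := hbase
  let s : (n : ℕ) → {s // J n s} := fun n => Nat.rec ⟨s0, hs0⟩ (fun n s => f n s) n
  have hs : ∀ n, s (n + 1) = f n (s n) := fun n => rfl
  have hca : CauchySeq fun n => (s n).1.1 := by
    refine cauchySeq_of_le_geometric (1 / 2) 1 (by norm_num) fun n => ?_
    obtain ⟨p, hp, hpe⟩ := hf1 n (s n)
    rw [hs, hpe]
    exact hPd _ _ p hp
  have hcb : CauchySeq fun n => (s n).1.2 := by
    refine cauchySeq_of_le_geometric (1 / 2) 1 (by norm_num) fun n => ?_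
    obtain ⟨p, hp, hpe⟩ := hf2 n (s n)
    rw [hs, hpe]
    exact hPd _ _ p hp
  obtain ⟨a, ha⟩ := cauchySeq_tendsto_of_complete hca
  obtain ⟨b, hb⟩ := cauchySeq_tendsto_of_complete hcb
  have hHc : IsClosed (H : Set G) := H.isClosed_of_isOpen hH
  have haH : a ∈ H := hHc.mem_of_tendsto ha (Eventually.of_forall fun n => (s n).2.1)
  have hbH : b ∈ H := hHc.mem_of_tendsto hb (Eventually.of_forall fun n => (s n).2.2.1)
  have heq : a • z = b • z' := by
    by_contra hne
    obtain ⟨A, B, hA, hB, haA, hbB, hdisj⟩ := t2_separation hne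
    have hA1 : (fun p : G × Z => p.1 • p.2) ⁻¹' A ∈ 𝓝 ((1 : G), a • z) :=
      (hA.preimage continuous_smul).mem_nhds (by simpa using haA)
    obtain ⟨W, M, hW, h1W, hM, haM, hWM⟩ := mem_nhds_prod_iff'.1 hA1
    obtain ⟨n0, hn0⟩ := hVb W (hW.mem_nhds h1W)
    have e1 : ∀ᶠ n in atTop, (s n).1.1 • z ∈ M :=
      (ha.smul_const z).eventually (hM.mem_nhds haM)
    have e2 : ∀ᶠ n in atTop, (s n).1.2 • z' ∈ B :=
      (hb.smul_const z').eventually (hB.mem_nhds hbB)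
    obtain ⟨n, hn1, hn2, hn3⟩ := (e1.and (e2.and (eventually_ge_atTop n0))).exists
    obtain ⟨p, hp, hpB⟩ := (s n).2.2.2 B (hτσ B hB) hn2
    have : (p, (s n).1.1 • z) ∈ W ×ˢ M := ⟨hn0 n hn3 (hPV _ _ hp), hn1⟩
    exact disjoint_left.1 hdisj (hWM this) hpB
  refine ⟨b⁻¹ * a, H.mul_mem (H.inv_mem hbH) haH, ?_⟩
  rw [mul_smul, heq, inv_smul_smul]

theorem exists_tests
    (hna : ∀ U ∈ 𝓝 (1 : G), ∃ V : Subgroup G, IsOpen (V : Set G) ∧ (V : Set G) ⊆ U)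
    {X : Type*} [TopologicalSpace X] [T1Space X]
    [σ : TopologicalSpace Z] [PolishSpace Z] [ContinuousSMul G Z]
    (Y : Set Z) (hY : @MeasurableSet Z (borel Z) Y) (π : Z → X) (hπ : Continuous π)
    (hYπ : ∀ z ∈ Y, ∀ y, (y ∈ Y ∧ π y = π z) ↔ ∃ g : G, g • z = y)
    (H : Subgroup G) (hH : IsOpen (H : Set G)) :
    ∃ B : Set (Set Z), B.Countable ∧ (∀ b ∈ B, @MeasurableSet Z (borel Z) b) ∧
      ∀ z ∈ Y, ∀ z' ∈ Y, π z' = π z →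
        ((∃ h ∈ H, h • z = z') ↔ ∀ b ∈ B, (z ∈ b ↔ z' ∈ b)) := by
  have hback := fun τ => back_forth (Z := Z) hna τ (σ := σ)
  have htau := fun t => tau_le (G := G) (t := t) (σ := σ)
  obtain ⟨t, htσ, htp, htY, htQ⟩ := exists_top (G := G) hY
  have hτσ : tauTop G t ≤ σ := htau t htσ
  have hsc : @SecondCountableTopology Z (tauTop G t) := tau_secondCountable htp
  have hb := @isBasis_countableBasis Z (tauTop G t) hsc
  have hbc := @countable_countableBasis Z (tauTop G t) hsc
  have hborel : @borel Z t = @borel Z σ := borel_eq_borel_of_le htp inferInstance htσ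
  let sat : Set Z → Set Z := fun O => ⋃ h ∈ H, {z | h • z ∈ O}
  refine ⟨sat '' (@countableBasis Z (tauTop G t) hsc), hbc.image _, ?_, ?_⟩
  · rintro _ ⟨O, hO, rfl⟩
    have h1 : IsOpen[tauTop G t] (sat O) :=
      @isOpen_biUnion Z _ (tauTop G t) _ _ fun h _ =>
        tau_smul h (@IsTopologicalBasis.isOpen Z (tauTop G t) _ _ hb hO)
    rw [← hborel]
    exact MeasurableSpace.measurableSet_generateFrom (tau_ge htQ _ h1)
  · intro z hz z' hz' hzz'
    constructor
    · rintro ⟨h, hh, rfl⟩ _ ⟨O, hO, rfl⟩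
      simp only [sat, mem_iUnion, exists_prop]
      constructor
      · rintro ⟨k, hk, hkz⟩
        refine ⟨k * h⁻¹, H.mul_mem hk (H.inv_mem hh), ?_⟩
        change (k * h⁻¹) • h • z ∈ O
        rw [smul_smul, inv_mul_cancel_right]
        exact hkz
      · rintro ⟨k, hk, hkz⟩
        refine ⟨k * h, H.mul_mem hk hh, ?_⟩
        change (k * h) • z ∈ O
        rw [mul_smul]
        exact hkz
    · intro htest
      let X' : Set Z := {y | y ∈ Y ∧ π y = π z}
      have hX'c : IsClosed[t] X' := by
        have h1 : IsClosed[t] (π ⁻¹' {π z}) :=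
          IsClosed.mono (@IsClosed.preimage Z X σ _ π hπ _ isClosed_singleton) htσ
        exact @IsClosed.inter Z _ _ t htY h1
      have horb : ∀ y ∈ X', ∀ y', y' ∈ X' ↔ ∃ g : G, g • y = y' := by
        rintro y ⟨hyY, hyz⟩ y'
        rw [← hYπ y hyY y', hyz]
        rfl
      refine hback (tauTop G t) hτσ X' ?_ ?_ H hH z z' ⟨hz, rfl⟩ ⟨hz', hzz'⟩ ?_
      · intro y hy g
        exact (horb y hy _).2 ⟨g, rfl⟩
      · intro y hy V hV
        exact @orbit_closure_nhd G Z _ _ _ _ _ hna t htp htQ X' hX'c y (horb y hy) V hV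
      · intro O hO hzO
        obtain ⟨O', hO'b, hzO', hO'O⟩ :=
          @IsTopologicalBasis.exists_subset_of_mem_open Z (tauTop G t) _ hb _ _ hzO hO
        have h1 := (htest _ ⟨O', hO'b, rfl⟩).1 (by
          simp only [sat, mem_iUnion, exists_prop]
          exact ⟨1, H.one_mem, by simpa using hzO'⟩)
        simp only [sat, mem_iUnion, exists_prop] at h1
        obtain ⟨h, hh, hhz⟩ := h1
        exact ⟨h, hh, hO'O hhz⟩

end Vaught

/-- `X × X` with the action on the second coordinate. -/
structure SndAct (X : Type*) where
  fst : X
  snd : X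

/-- The identification with `X × X`. -/
def SndAct.eqv (X : Type*) : SndAct X ≃ X × X where
  toFun p := (p.fst, p.snd)
  invFun p := ⟨p.1, p.2⟩

instance sndActTop {X : Type*} [TopologicalSpace X] : TopologicalSpace (SndAct X) :=
  TopologicalSpace.induced (SndAct.eqv X) inferInstance

/-- The identification with `X × X` as a homeomorphism. -/
def SndAct.homeo (X : Type*) [TopologicalSpace X] : SndAct X ≃ₜ X × X :=
  (SndAct.eqv X).toHomeomorphOfIsInducing ⟨rfl⟩

instance sndActAct {G X : Type*} [Group G] [MulAction G X] : MulAction G (SndAct X) where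
  smul g p := ⟨p.fst, g • p.snd⟩
  one_smul p := by
    change (⟨p.fst, (1 : G) • p.snd⟩ : SndAct X) = p
    rw [one_smul]
  mul_smul g h p := by
    change (⟨p.fst, (g * h) • p.snd⟩ : SndAct X) = ⟨p.fst, g • h • p.snd⟩
    rw [mul_smul]

theorem general_thm {G X : Type*} [Group G] [TopologicalSpace G] [IsTopologicalGroup G]
    [PolishSpace G]
    (hna : ∀ U ∈ 𝓝 (1 : G), ∃ V : Subgroup G, IsOpen (V : Set G) ∧ (V : Set G) ⊆ U)
    [TopologicalSpace X] [PolishSpace X] [MulAction G X] [ContinuousSMul G X]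
    (H : Subgroup G) (hH : IsOpen (H : Set G)) :
    @MeasurableSet (X × X) (borel (X × X)) {p : X × X | ∃ g : G, g • p.1 = p.2} ↔
    @MeasurableSet (X × X) (borel (X × X)) {p : X × X | ∃ h ∈ H, h • p.1 = p.2} := by
  let : MeasurableSpace (X × X) := borel (X × X)
  have : BorelSpace (X × X) := ⟨rfl⟩
  constructor
  · intro hE
    have hpol : PolishSpace (SndAct X) := (SndAct.homeo X).isClosedEmbedding.polishSpace
    have hfst : Continuous (SndAct.fst : SndAct X → X) :=
      continuous_fst.comp (SndAct.homeo X).continuous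
    have hsnd : Continuous (SndAct.snd : SndAct X → X) :=
      continuous_snd.comp (SndAct.homeo X).continuous
    have hmk : ∀ {T : Type _} [TopologicalSpace T] (f g : T → X), Continuous f → Continuous g →
        Continuous fun x => (⟨f x, g x⟩ : SndAct X) := by
      intro T _ f g hf hg
      exact (SndAct.homeo X).symm.continuous.comp (hf.prodMk hg)
    have hact : ContinuousSMul G (SndAct X) := by
      refine ⟨?_⟩
      refine (SndAct.homeo X).symm.continuous.comp (f := fun p : G × SndAct X =>
        (p.2.fst, p.1 • p.2.snd)) ?_
      exact (hfst.comp continuous_snd).prodMk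
        (continuous_fst.smul (hsnd.comp continuous_snd))
    let : MeasurableSpace (SndAct X) := borel (SndAct X)
    have : BorelSpace (SndAct X) := ⟨rfl⟩
    have hY := (SndAct.homeo X).continuous.measurable hE
    obtain ⟨B, hBc, hBm, hB⟩ := exists_tests hna _ hY SndAct.fst hfst (by
      rintro ⟨x, y⟩ ⟨g, hg⟩ ⟨x', y'⟩
      have hg : g • x = y := hg
      constructor
      · rintro ⟨⟨g', hg'⟩, hxx⟩
        have hg' : g' • x' = y' := hg'
        have hxx : x' = x := hxx
        refine ⟨g' * g⁻¹, ?_⟩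
        change (⟨x, (g' * g⁻¹) • y⟩ : SndAct X) = _
        rw [← hg, smul_smul, inv_mul_cancel_right, ← hxx, hg']
      · rintro ⟨k, hk⟩
        have hk : (⟨x, k • y⟩ : SndAct X) = ⟨x', y'⟩ := hk
        injection hk with h1 h2
        subst h1 h2
        refine ⟨⟨k * g, ?_⟩, rfl⟩
        change (k * g) • x = k • y
        rw [mul_smul, hg]) H hH
    have key : {p : X × X | ∃ h ∈ H, h • p.1 = p.2} = {p : X × X | ∃ g : G, g • p.1 = p.2} ∩
        ⋂ b ∈ B, {p | (⟨p.1, p.1⟩ : SndAct X) ∈ b ↔ (⟨p.1, p.2⟩ : SndAct X) ∈ b} := by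
      ext ⟨x, y⟩
      simp only [mem_inter_iff, mem_iInter, mem_ofPred_eq]
      have hxx : (⟨x, x⟩ : SndAct X) ∈ (SndAct.homeo X) ⁻¹' {p : X × X | ∃ g : G, g • p.1 = p.2} :=
        ⟨1, one_smul G x⟩
      have hiff : (∃ h ∈ H, h • (⟨x, x⟩ : SndAct X) = ⟨x, y⟩) ↔ ∃ h ∈ H, h • x = y := by
        constructor
        · rintro ⟨h, hh, he⟩
          have he : (⟨x, h • x⟩ : SndAct X) = ⟨x, y⟩ := he
          injection he with _ h2
          exact ⟨h, hh, h2⟩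
        · rintro ⟨h, hh, rfl⟩
          exact ⟨h, hh, rfl⟩
      constructor
      · intro hh
        have hE : ∃ g : G, g • x = y := ⟨hh.choose, hh.choose_spec.2⟩
        exact ⟨hE, (hB ⟨x, x⟩ hxx ⟨x, y⟩ hE rfl).1 (hiff.2 hh)⟩
      · rintro ⟨hE, hb⟩
        exact hiff.1 ((hB ⟨x, x⟩ hxx ⟨x, y⟩ hE rfl).2 hb)
    rw [key]
    refine hE.inter (.biInter hBc fun b hb => ?_)
    have m1 : MeasurableSet {p : X × X | (⟨p.1, p.1⟩ : SndAct X) ∈ b} :=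
      (hmk _ _ continuous_fst continuous_fst).measurable (hBm b hb)
    have m2 : MeasurableSet {p : X × X | (⟨p.1, p.2⟩ : SndAct X) ∈ b} :=
      (hmk _ _ continuous_fst continuous_snd).measurable (hBm b hb)
    exact m1.iff m2
  · intro hE
    have key : {p : X × X | ∃ g : G, g • p.1 = p.2} =
        ⋃ n, (fun p : X × X => (p.1, (denseSeq G n)⁻¹ • p.2)) ⁻¹'
          {p : X × X | ∃ h ∈ H, h • p.1 = p.2} := by
      ext ⟨x, y⟩
      simp only [mem_iUnion, mem_preimage, mem_ofPred_eq]
      constructor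
      · rintro ⟨k, rfl⟩
        obtain ⟨n, hn⟩ := (denseRange_denseSeq G).exists_mem_open
          (hH.preimage (f := fun u => k⁻¹ * u) (by fun_prop)) ⟨k, by simp⟩
        refine ⟨n, (k⁻¹ * denseSeq G n)⁻¹, H.inv_mem hn, ?_⟩
        rw [mul_inv_rev, inv_inv, mul_smul]
      · rintro ⟨n, h, -, hh⟩
        refine ⟨denseSeq G n * h, ?_⟩
        rw [mul_smul, hh, smul_inv_smul]
    rw [key]
    refine .iUnion fun n => ?_
    refine (Continuous.measurable ?_) hE
    exact continuous_fst.prodMk (continuous_snd.const_smul _)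

theorem Sinf_continuous_eval (n : ℕ) : Continuous fun g : Sinf => g n :=
  (continuous_apply n).comp (continuous_induced_dom (f := fun g : Sinf => (g : ℕ → ℕ)))

theorem Sinf_continuous_iff {T : Type*} [TopologicalSpace T] {f : T → Sinf} :
    Continuous f ↔ ∀ n, Continuous fun t => f t n := by
  rw [continuous_induced_rng, continuous_pi_iff]
  rfl

theorem Sinf_isOpen_eval (n m : ℕ) : IsOpen {g : Sinf | g n = m} :=
  (isOpen_discrete {m}).preimage (Sinf_continuous_eval n)

instance Sinf_topGroup : IsTopologicalGroup Sinf where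
  continuous_mul := by
    rw [Sinf_continuous_iff]
    intro n
    rw [continuous_discrete_rng]
    intro m
    have : (fun p : Sinf × Sinf => (p.1 * p.2) n) ⁻¹' {m} =
        ⋃ k, {g : Sinf | g k = m} ×ˢ {g : Sinf | g n = k} := by
      ext ⟨g, h⟩
      simp
    rw [this]
    exact isOpen_iUnion fun k => (Sinf_isOpen_eval k m).prod (Sinf_isOpen_eval n k)
  continuous_inv := by
    rw [Sinf_continuous_iff]
    intro n
    rw [continuous_discrete_rng]
    intro m
    have : (fun g : Sinf => g⁻¹ n) ⁻¹' {m} = {g : Sinf | g m = n} := by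
      ext g
      simp only [mem_preimage, mem_singleton_iff, mem_ofPred_eq]
      rw [Equiv.Perm.inv_eq_iff_eq]
      exact eq_comm
    rw [this]
    exact Sinf_isOpen_eval m n

instance Sinf_polish : PolishSpace Sinf := by
  let f : Sinf → (ℕ → ℕ) × (ℕ → ℕ) := fun g => (g, (g⁻¹ : Sinf))
  have hc1 : Continuous fun g : Sinf => (g : ℕ → ℕ) := continuous_induced_dom
  have hc : Continuous f := hc1.prodMk (hc1.comp continuous_inv)
  have hind : IsInducing f := by
    have h1 : IsInducing (Prod.fst ∘ f) := ⟨rfl⟩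
    exact IsInducing.of_comp hc continuous_fst h1
  have hinj : Function.Injective f := by
    intro g h hgh
    exact DFunLike.coe_injective (Prod.ext_iff.1 hgh).1
  have hr : range f = ⋂ n : ℕ, {p | p.1 (p.2 n) = n} ∩ {p | p.2 (p.1 n) = n} := by
    ext ⟨u, v⟩
    simp only [mem_iInter, mem_inter_iff, mem_ofPred_eq, mem_range]
    constructor
    · rintro ⟨g, hg⟩ n
      obtain ⟨rfl, rfl⟩ := Prod.ext_iff.1 hg
      simp [f]
    · intro h
      exact ⟨⟨u, v, fun n => (h n).2, fun n => (h n).1⟩, rfl⟩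
  have hev : ∀ n : ℕ, Continuous fun p : (ℕ → ℕ) × (ℕ → ℕ) => p.1 (p.2 n) := by
    intro n
    rw [continuous_discrete_rng]
    intro m
    have : (fun p : (ℕ → ℕ) × (ℕ → ℕ) => p.1 (p.2 n)) ⁻¹' {m} =
        ⋃ k, {u : ℕ → ℕ | u k = m} ×ˢ {v : ℕ → ℕ | v n = k} := by
      ext ⟨g, h⟩
      simp
    rw [this]
    have hop : ∀ i j : ℕ, IsOpen {u : ℕ → ℕ | u i = j} := by
      intro i j
      have hci : Continuous fun u : ℕ → ℕ => u i := continuous_apply i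
      exact (isOpen_discrete ({j} : Set ℕ)).preimage hci
    exact isOpen_iUnion fun k => (hop k m).prod (hop n k)
  have hcl : IsClosed (range f) := by
    rw [hr]
    refine isClosed_iInter fun n => IsClosed.inter ?_ ?_
    · exact isClosed_eq (hev n) continuous_const
    · exact isClosed_eq ((hev n).comp continuous_swap) continuous_const
  exact (IsClosedEmbedding.mk ⟨hind, hinj⟩ hcl).polishSpace

theorem Sinf_nonarch (U : Set Sinf) (hU : U ∈ 𝓝 (1 : Sinf)) :
    ∃ V : Subgroup Sinf, IsOpen (V : Set Sinf) ∧ (V : Set Sinf) ⊆ U := by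
  rw [nhds_induced, mem_comap] at hU
  obtain ⟨T, hT, hTU⟩ := hU
  rw [nhds_pi, Filter.mem_pi] at hT
  obtain ⟨I, hI, t, ht, hIt⟩ := hT
  let V : Subgroup Sinf :=
    { carrier := {g | ∀ i ∈ I, g i = i}
      one_mem' := fun i _ => rfl
      mul_mem' := by
        intro a b ha hb i hi
        rw [Equiv.Perm.mul_apply, hb i hi, ha i hi]
      inv_mem' := by
        intro a ha i hi
        rw [Equiv.Perm.inv_eq_iff_eq, ha i hi] }
  refine ⟨V, ?_, ?_⟩
  · have : (V : Set Sinf) = ⋂ i ∈ I, {g : Sinf | g i = i} := by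
      ext g
      simp only [mem_iInter]
      rfl
    rw [this]
    exact hI.isOpen_biInter fun i _ => Sinf_isOpen_eval i i
  · intro g hg
    refine hTU (hIt fun i hi => ?_)
    change g i ∈ t i
    rw [hg i hi]
    exact mem_of_mem_nhds (ht i)

/-- Borel orbit equivalence relations pass to open subgroups. -/
theorem borel_orbit_equivalence_open_subgroup
    (G : Subgroup Sinf) (hGclosed : IsClosed (G : Set Sinf))
    {X : Type*} [TopologicalSpace X] [PolishSpace X] [MulAction G X] [ContinuousSMul G X]
    (H : Subgroup G) (hH : IsOpen (H : Set G)) :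
    @MeasurableSet (X × X) (borel (X × X)) {p : X × X | ∃ g : G, g • p.1 = p.2} ↔
    @MeasurableSet (X × X) (borel (X × X)) {p : X × X | ∃ h ∈ H, h • p.1 = p.2} := by
  have : PolishSpace G := hGclosed.polishSpace
  refine general_thm ?_ H hH
  intro U hU
  rw [nhds_subtype, mem_comap] at hU
  obtain ⟨T, hT, hTU⟩ := hU
  obtain ⟨V, hV, hVT⟩ := Sinf_nonarch T hT
  exact ⟨V.subgroupOf G, hV.preimage continuous_subtype_val, fun g hg => hTU (hVT hg)⟩
end
end

section
/- Becker–Kechris criterion for closed permutation groups: Let G be a closed subgroup of S_∞ and X a Polish G-space. Then the following are equivalent: (i) the orbit equivalence relation E_G = {(x,y) ∈ X×X : ∃g ∈ G, g·x = y} is a Borel subset of X×X; (ii) the stabilizer map τ : X → F(G), τ(x) = G_x = {g ∈ G : g·x = x}, is Borel measurable from X (with its Borel σ-algebra) to the Effros Borel space F(G). -/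
open Set Pointwise

noncomputable section

section BKgeneral

open Topology TopologicalSpace MeasureTheory Filter

set_option linter.unusedSectionVars false
set_option linter.style.haveILetI false

variable {G : Type*} [Group G] [TopologicalSpace G] [IsTopologicalGroup G] [PolishSpace G]

/-- Vaught transform `A^{△U}`. -/
def bkV {Z : Type*} [MulAction G Z] (A : Set Z) (U : Set G) : Set Z :=
  {z | ¬ IsMeagre {g : G | g ∈ U ∧ g • z ∈ A}}

lemma bkV_mono {Z : Type*} [MulAction G Z] {A : Set Z} {U U' : Set G} (h : U ⊆ U') :
    bkV A U ⊆ bkV A U' := by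
  intro z hz hm
  refine hz (hm.mono ?_)
  rintro g hg
  exact ⟨h hg.1, hg.2⟩

lemma bkV_smul {Z : Type*} [MulAction G Z] (A : Set Z) (U : Set G) (g : G) (z : Z) :
    g • z ∈ bkV A U ↔ z ∈ bkV A ((fun k => k * g⁻¹) ⁻¹' U) := by
  have e1 : {h : G | h ∈ (fun k => k * g⁻¹) ⁻¹' U ∧ h • z ∈ A} =
      (Homeomorph.mulRight g⁻¹) ⁻¹' {h : G | h ∈ U ∧ h • g • z ∈ A} := by
    ext h; simp [smul_smul]
  have e2 : {h : G | h ∈ U ∧ h • g • z ∈ A} = (Homeomorph.mulRight g) ⁻¹'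
      {h : G | h ∈ (fun k => k * g⁻¹) ⁻¹' U ∧ h • z ∈ A} := by
    ext h; simp [smul_smul]
  unfold bkV
  refine not_congr ⟨fun h => ?_, fun h => ?_⟩
  · rw [e1]; exact h.preimage_of_isOpenMap (Homeomorph.continuous _) (Homeomorph.isOpenMap _)
  · rw [e2]; exact h.preimage_of_isOpenMap (Homeomorph.continuous _) (Homeomorph.isOpenMap _)

lemma bkV_iUnion {Z : Type*} [MulAction G Z] (A : Set Z) {ι : Type*} (U : ι → Set G)
    (hU : ∀ i, IsOpen (U i)) : bkV A (⋃ i, U i) = ⋃ i, bkV A (U i) := by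
  apply Subset.antisymm
  · intro z hz
    obtain ⟨T, hT, hTU⟩ := isOpen_iUnion_countable U hU
    by_contra hcon
    simp only [mem_iUnion, not_exists] at hcon
    apply hz
    have : {g : G | g ∈ ⋃ i, U i ∧ g • z ∈ A} ⊆ ⋃ i ∈ T, {g : G | g ∈ U i ∧ g • z ∈ A} := by
      rw [← hTU]
      rintro g ⟨hg, hA⟩
      simp only [mem_iUnion] at hg ⊢
      obtain ⟨i, hi, hg⟩ := hg
      exact ⟨i, hi, hg, hA⟩
    refine IsMeagre.mono this (isMeagre_biUnion hT fun i _ => ?_)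
    have := hcon i
    simpa [bkV] using this
  · exact iUnion_subset fun i => bkV_mono (subset_iUnion U i)

lemma bkV_sUnion_set {Z : Type*} [MulAction G Z] (A : ℕ → Set Z) (U : Set G) :
    bkV (⋃ n, A n) U = ⋃ n, bkV (A n) U := by
  ext z
  simp only [bkV, mem_iUnion, mem_ofPred_eq]
  rw [← not_forall, not_iff_not]
  constructor
  · intro h n
    refine h.mono ?_
    rintro g hg
    exact ⟨hg.1, n, hg.2⟩
  · intro h
    refine (isMeagre_iUnion h).mono ?_
    rintro g ⟨h1, n, h2⟩
    exact mem_iUnion.2 ⟨n, h1, h2⟩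

/-- nonmeager sets localize -/
lemma bk_localize {S U : Set G} (hS : BaireMeasurableSet S) (hU : IsOpen U) :
    ¬ IsMeagre {g | g ∈ U ∧ g ∈ S} ↔
      ∃ W ∈ countableBasis G, W ⊆ U ∧ IsMeagre {g | g ∈ W ∧ g ∉ S} := by
  constructor
  · intro h
    obtain ⟨O, hO, hSO⟩ := hS.residualEq_isOpen
    have hne : (U ∩ O).Nonempty := by
      by_contra hcon
      rw [not_nonempty_iff_eq_empty] at hcon
      apply h
      filter_upwards [hSO] with g hg
      rintro ⟨h1, h2⟩
      have : g ∈ O := by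
        have := (show (g ∈ S) = (g ∈ O) from hg) ▸ h2
        exact this
      exact (hcon ▸ (⟨h1, this⟩ : g ∈ U ∩ O) : g ∈ (∅ : Set G))
    obtain ⟨g, hg⟩ := hne
    obtain ⟨W, hW, hgW, hWU⟩ := (isBasis_countableBasis G).exists_subset_of_mem_open hg
      (hU.inter hO)
    refine ⟨W, hW, fun k hk => (hWU hk).1, ?_⟩
    filter_upwards [hSO] with k hk
    rintro ⟨h1, h2⟩
    apply h2
    exact (show (k ∈ S) = (k ∈ O) from hk) ▸ (hWU h1).2
  · rintro ⟨W, hW, hWU, hm⟩ hcon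
    have := (hm.union hcon)
    refine not_isMeagre_of_isOpen (isOpen_of_mem_countableBasis hW)
      (nonempty_of_mem_countableBasis hW) (this.mono ?_)
    intro g hg
    by_cases h : g ∈ S
    · exact Or.inr ⟨hWU hg, h⟩
    · exact Or.inl ⟨hg, h⟩

lemma bkV_measurable {Z : Type*} [MulAction G Z] [TopologicalSpace Z] [ContinuousSMul G Z]
    [MeasurableSpace Z] [BorelSpace Z] {A : Set Z} (hA : MeasurableSet A) :
    ∀ U : Set G, IsOpen U → MeasurableSet (bkV A U) := by
  borelize G
  have hBP : ∀ A : Set Z, MeasurableSet A → ∀ z, BaireMeasurableSet {g : G | g • z ∈ A} := by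
    intro A hA z
    apply MeasurableSet.baireMeasurableSet
    exact (by fun_prop : Continuous fun g : G => g • z).measurable hA
  induction A, hA using MeasurableSet.induction_on_open with
  | isOpen A hA =>
    intro U hU
    apply IsOpen.measurableSet
    have : bkV A U = ⋃ g ∈ U, (fun z => g • z) ⁻¹' A := by
      ext z
      simp only [bkV, mem_ofPred_eq, mem_iUnion, mem_preimage, exists_prop]
      constructor
      · intro h; exact nonempty_of_not_isMeagre h
      · intro h
        refine not_isMeagre_of_isOpen ?_ h
        exact hU.inter (hA.preimage (by fun_prop : Continuous fun g : G => g • z))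
    rw [this]
    exact isOpen_biUnion fun g _ => hA.preimage (continuous_const_smul g)
  | compl A hA ih =>
    intro U hU
    have : bkV Aᶜ U = ⋃ W ∈ {W | W ∈ countableBasis G ∧ W ⊆ U}, (bkV A W)ᶜ := by
      ext z
      have := bk_localize (hBP Aᶜ hA.compl z) hU
      simp only [bkV, mem_ofPred_eq, mem_iUnion, mem_compl_iff, exists_prop, not_not] at this ⊢
      simp only [this, and_assoc]
    rw [this]
    refine MeasurableSet.biUnion ((countable_countableBasis G).mono fun W h => h.1) ?_
    intro W hW
    exact (ih W (isOpen_of_mem_countableBasis hW.1)).compl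
  | iUnion f _ hf ih =>
    intro U hU
    rw [bkV_sUnion_set]
    exact MeasurableSet.iUnion fun n => ih n U hU

/-- Closedness of `V`-orbits in a transitive Baire action. -/
lemma bk_orbit_closed {T : Type*} [TopologicalSpace T] [BaireSpace T] [MulAction G T]
    [ContinuousConstSMul G T] [MulAction.IsPretransitive G T] (V : Subgroup G)
    (hV : IsOpen (V : Set G))
    (hBP : ∀ y : T, BaireMeasurableSet (MulAction.orbit V y))
    (x y : T) (h : ∀ O : Set T, IsOpen O → y ∈ O → ∃ v ∈ V, v • x ∈ O) :
    y ∈ MulAction.orbit V x := by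
  have meag : ∀ (g : G) (S : Set T), IsMeagre S → IsMeagre ((fun z => g • z) ⁻¹' S) := by
    intro g S hS
    exact hS.preimage_of_isOpenMap (Homeomorph.smul g).continuous (Homeomorph.smul g).isOpenMap
  have orb : ∀ (v : G) (_ : v ∈ V) (z w : T), v • z ∈ MulAction.orbit V w ↔
      z ∈ MulAction.orbit V w := by
    intro v hv z w
    constructor
    · rintro ⟨a, ha⟩
      exact ⟨⟨v, hv⟩⁻¹ * a, by
        simp only [Subgroup.smul_def] at ha ⊢
        simp [mul_smul, ha]⟩
    · rintro ⟨a, rfl⟩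
      exact ⟨⟨v, hv⟩ * a, by simp [mul_smul, Subgroup.smul_def]⟩
  have key : ∀ y : T, ∃ O : Set T, IsOpen O ∧ y ∈ O ∧
      IsMeagre {z | z ∈ O ∧ z ∉ MulAction.orbit V y} := by
    intro y
    have hne : ¬ IsMeagre (MulAction.orbit V y) := by
      intro hm
      obtain ⟨C, hC, hCU⟩ := isOpen_iUnion_countable (fun g : G => (fun k => g * k) ⁻¹' (V : Set G))
        (fun g => hV.preimage (by fun_prop))
      have : (univ : Set T) ⊆ ⋃ g ∈ C, (fun z => g • z) ⁻¹' (MulAction.orbit V y) := by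
        intro z _
        obtain ⟨k, rfl⟩ := MulAction.exists_smul_eq G y z
        have : k ∈ ⋃ g : G, (fun k => g * k) ⁻¹' (V : Set G) :=
          mem_iUnion.2 ⟨k⁻¹, by simp⟩
        rw [← hCU] at this
        simp only [mem_iUnion, mem_preimage, exists_prop] at this ⊢
        obtain ⟨g, hg, hgk⟩ := this
        refine ⟨g, hg, ?_⟩
        rw [smul_smul, orb _ hgk]
        exact MulAction.mem_orbit_self y
      have hmm := (isMeagre_biUnion hC fun g _ => meag g _ hm).mono this
      exact not_isMeagre_of_isOpen isOpen_univ ⟨y, trivial⟩ hmm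
    obtain ⟨O, hO, hSO⟩ := (hBP y).residualEq_isOpen
    have hOm : IsMeagre {z | z ∈ O ∧ z ∉ MulAction.orbit V y} := by
      filter_upwards [hSO] with k hk
      rintro ⟨h1, h2⟩
      exact h2 ((show (k ∈ MulAction.orbit V y) = (k ∈ O) from hk) ▸ h1)
    have : ∃ v ∈ V, v • y ∈ O := by
      by_contra hcon
      push Not at hcon
      apply hne
      filter_upwards [hSO] with k hk
      rintro h1
      have h2 : k ∈ O := (show (k ∈ MulAction.orbit V y) = (k ∈ O) from hk) ▸ h1
      obtain ⟨v, rfl⟩ := h1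
      exact hcon v v.2 h2
    obtain ⟨v, hv, hvy⟩ := this
    refine ⟨(fun z => v • z) ⁻¹' O, hO.preimage (continuous_const_smul v), hvy, ?_⟩
    refine (meag v _ hOm).mono ?_
    rintro z ⟨h1, h2⟩
    exact ⟨h1, by rwa [orb v hv]⟩
  obtain ⟨O, hO, hyO, hOm⟩ := key y
  obtain ⟨v, hv, hvx⟩ := h O hO hyO
  obtain ⟨O', hO', hxO', hOm'⟩ := key (v • x)
  by_contra hcon
  refine not_isMeagre_of_isOpen (hO.inter hO') ⟨_, hvx, hxO'⟩ ((hOm.union hOm').mono ?_)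
  rintro z ⟨h1, h2⟩
  by_cases hz : z ∈ MulAction.orbit V y
  · right
    refine ⟨h2, fun hz' => hcon ?_⟩
    obtain ⟨a, rfl⟩ := hz
    have e1 : y ∈ MulAction.orbit V (v • x) := (orb a a.2 _ _).1 hz'
    obtain ⟨b, rfl⟩ := e1
    exact ⟨b * ⟨v, hv⟩, by simp [mul_smul, Subgroup.smul_def]⟩
  · exact Or.inl ⟨h1, hz⟩

/-- `V`-orbits inside a Borel `G`-orbit are Borel. -/
lemma bk_Vorbit_meas {Z : Type*} [TopologicalSpace Z] [PolishSpace Z] [MeasurableSpace Z]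
    [BorelSpace Z] [MulAction G Z] [ContinuousSMul G Z] (V : Subgroup G)
    (hV : IsOpen (V : Set G)) (y : Z) (horb : MeasurableSet (MulAction.orbit G y)) :
    MeasurableSet (MulAction.orbit V y) := by
  have han : ∀ z : Z, AnalyticSet (MulAction.orbit V z) := by
    intro z
    have : MulAction.orbit V z = (fun g : G => g • z) '' (V : Set G) := by
      ext w
      simp only [MulAction.mem_orbit_iff, mem_image, SetLike.mem_coe]
      constructor
      · rintro ⟨v, rfl⟩
        exact ⟨v, v.2, rfl⟩
      · rintro ⟨v, hv, rfl⟩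
        exact ⟨⟨v, hv⟩, rfl⟩
    rw [this]
    exact hV.analyticSet_image (by fun_prop)
  apply (han y).measurableSet_of_compl
  obtain ⟨C, hC, hCU⟩ := isOpen_iUnion_countable (fun g : G => (fun k => k * g) ⁻¹' (V : Set G))
    (fun g => hV.preimage (by fun_prop))
  have hcompl : (MulAction.orbit V y)ᶜ = (MulAction.orbit G y)ᶜ ∪
      ⋃ g : {g : G // g ∈ C ∧ g⁻¹ • y ∉ MulAction.orbit V y},
        MulAction.orbit V ((g : G)⁻¹ • y) := by
    ext z
    simp only [mem_compl_iff, mem_union, mem_iUnion]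
    constructor
    · intro hz
      by_cases hzG : z ∈ MulAction.orbit G y
      · right
        obtain ⟨k, rfl⟩ := hzG
        have : k ∈ ⋃ g : G, (fun k => k * g) ⁻¹' (V : Set G) :=
          mem_iUnion.2 ⟨k⁻¹, by simp⟩
        rw [← hCU] at this
        simp only [mem_iUnion, mem_preimage, exists_prop] at this
        obtain ⟨g, hg, hgk⟩ := this
        have e : k • y ∈ MulAction.orbit V (g⁻¹ • y) :=
          ⟨⟨k * g, hgk⟩, by simp [Subgroup.smul_def, smul_smul]⟩
        refine ⟨⟨g, hg, fun hcon => hz ?_⟩, e⟩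
        rw [← MulAction.orbit_eq_iff] at hcon e ⊢
        exact e.trans hcon
      · exact Or.inl hzG
    · rintro (h | ⟨⟨g, hg, hgy⟩, h⟩) hz
      · exact h (MulAction.mem_orbit_of_mem_orbit_subgroup hz)
      · apply hgy
        rw [← MulAction.orbit_eq_iff] at hz h ⊢
        exact h.symm.trans hz
  rw [hcompl]
  have : Countable {g : G // g ∈ C ∧ g⁻¹ • y ∉ MulAction.orbit V y} :=
    (hC.mono fun g (hg : g ∈ {g : G | g ∈ C ∧ g⁻¹ • y ∉ MulAction.orbit V y}) => hg.1).to_subtype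
  rw [union_eq_iUnion]
  apply AnalyticSet.iUnion
  rintro (b | b)
  · exact AnalyticSet.iUnion fun g => han _
  · exact horb.compl.analyticSet

lemma bk_core {Z : Type*} [TopologicalSpace Z] [PolishSpace Z] [MeasurableSpace Z]
    [BorelSpace Z] [MulAction G Z] [ContinuousSMul G Z] (V : Subgroup G)
    (hV : IsOpen (V : Set G)) (z0 : Z) (horb : MeasurableSet (MulAction.orbit G z0))
    {K : Type*} [TopologicalSpace K] [PolishSpace K] (q : K → Z) (hqc : Continuous q)
    (hq : ∀ k, q k ∈ MulAction.orbit G z0) (B : Set (Set Z))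
    (h1 : ∀ k : K, ∀ O : Set K, IsOpen O → k ∈ O → ∃ A ∈ B, q k ∈ A ∧ q ⁻¹' A ⊆ O)
    (h2 : ∀ k : K, ∀ A ∈ B, q k ∈ A → ∀ U : Set G, IsOpen U → 1 ∈ U → q k ∈ bkV A U)
    (h3 : ∀ z ∈ MulAction.orbit G z0, ∀ᶠ g in residual G, ∃ k, q k = g • z)
    (h4 : ∀ A ∈ B, ∀ U : Set G, IsOpen U → IsOpen (q ⁻¹' (bkV A U)))
    (x y : Z) (hx : x ∈ MulAction.orbit G z0) (hy : y ∈ MulAction.orbit G z0)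
    (hxy : ∀ A ∈ B, ∀ U ∈ countableBasis G, y ∈ bkV A (U * (V : Set G)) →
      x ∈ bkV A (U * (V : Set G))) :
    y ∈ MulAction.orbit V x := by
  let T := MulAction.orbit G z0
  letI t' : TopologicalSpace T := generateFrom
    {s | ∃ A ∈ B, ∃ U : Set G, IsOpen U ∧ s = (fun z : T => (z : Z)) ⁻¹' (bkV A U)}
  have hopen : ∀ A ∈ B, ∀ U : Set G, IsOpen U →
      IsOpen ((fun z : T => (z : Z)) ⁻¹' (bkV A U)) := fun A hA U hU =>
    isOpen_generateFrom_of_mem ⟨A, hA, U, hU, rfl⟩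
  haveI : ContinuousConstSMul G T := by
    refine ⟨fun g => continuous_generateFrom_iff.2 ?_⟩
    rintro s ⟨A, hA, U, hU, rfl⟩
    have : (fun z : T => g • z) ⁻¹' ((fun z : T => (z : Z)) ⁻¹' (bkV A U)) =
        (fun z : T => (z : Z)) ⁻¹' (bkV A ((fun k => k * g⁻¹) ⁻¹' U)) := by
      ext z
      simp only [mem_preimage, ← bkV_smul]
      rfl
    rw [this]
    exact hopen A hA _ (hU.preimage (by fun_prop))
  let p : G × K → T := fun a => a.1 • (⟨q a.2, hq a.2⟩ : T)
  have hpv : ∀ a, ((p a : T) : Z) = a.1 • q a.2 := fun a => rfl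
  have hpc : Continuous p := by
    refine continuous_generateFrom_iff.2 ?_
    rintro s ⟨A, hA, U, hU, rfl⟩
    rw [isOpen_iff_forall_mem_open]
    rintro ⟨g, k⟩ hgk
    have hgk : g • q k ∈ bkV A U := hgk
    rw [bkV_smul] at hgk
    have hcov : (fun k => k * g⁻¹) ⁻¹' U = ⋃ W : {W : Set G × Set G // IsOpen W.1 ∧ IsOpen W.2 ∧
        g ∈ W.2 ∧ ∀ w ∈ W.1, ∀ g' ∈ W.2, w * g'⁻¹ ∈ U}, W.1.1 := by
      ext h
      simp only [mem_preimage, mem_iUnion, Subtype.exists, exists_prop, Prod.exists]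
      constructor
      · intro hh
        have hc : Continuous fun a : G × G => a.1 * a.2⁻¹ := by fun_prop
        obtain ⟨W, N, hW, hN, hhW, hgN, hWN⟩ := isOpen_prod_iff.1 (hU.preimage hc) h g hh
        exact ⟨W, N, ⟨hW, hN, hgN, fun w hw g' hg' => hWN (mk_mem_prod hw hg')⟩, hhW⟩
      · rintro ⟨W, N, ⟨hW, hN, hgN, hh⟩, hhW⟩
        exact hh h hhW g hgN
    rw [hcov, bkV_iUnion _ _ (fun W => W.2.1)] at hgk
    obtain ⟨⟨⟨W, N⟩, hW, hN, hgN, hWN⟩, hk⟩ := mem_iUnion.1 hgk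
    refine ⟨N ×ˢ (q ⁻¹' bkV A W), ?_, hN.prod (h4 A hA W hW), hgN, hk⟩
    rintro ⟨g', k'⟩ ⟨hg', hk'⟩
    change g' • q k' ∈ bkV A U
    rw [bkV_smul]
    exact bkV_mono (fun w hw => hWN w hw g' hg') hk'
  have hps : Function.Surjective p := by
    rintro ⟨z, hz⟩
    obtain ⟨g, k, hk⟩ := (dense_of_mem_residual (h3 z hz)).nonempty
    exact ⟨(g⁻¹, k), Subtype.ext (by rw [hpv]; simp [hk])⟩
  have hbasis : ∀ N : Set (G × K), IsOpen N → ∀ g k, (g, k) ∈ N → ∃ A ∈ B, ∃ U ∈ countableBasis G,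
      g • q k ∈ bkV A U ∧ ∀ w : T, (w : Z) ∈ bkV A U → w ∈ p '' N := by
    intro N hN g k hgk
    obtain ⟨U', O, hU', hO, hgU', hkO, hsub⟩ := isOpen_prod_iff.1 hN g k hgk
    obtain ⟨A, hA, hkA, hAO⟩ := h1 k O hO hkO
    obtain ⟨U, hU, hgU, hUU'⟩ := (isBasis_countableBasis G).exists_subset_of_mem_open
      (show g⁻¹ ∈ (fun h => h⁻¹) ⁻¹' U' by simpa using hgU') (hU'.preimage continuous_inv)
    refine ⟨A, hA, U, hU, ?_, ?_⟩
    · rw [bkV_smul]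
      refine h2 k A hA hkA _ ((isOpen_of_mem_countableBasis hU).preimage (by fun_prop)) ?_
      simpa using hgU
    · rintro ⟨w, hw⟩ hwA
      have h3w := h3 w hw
      have : ∃ h : G, (h ∈ U ∧ h • w ∈ A) ∧ ∃ k, q k = h • w := by
        by_contra hcon
        push Not at hcon
        apply hwA
        filter_upwards [h3w] with h hh
        rintro hh'
        obtain ⟨k, hk⟩ := hh
        exact hcon h hh' k hk
      obtain ⟨h, ⟨hhU, hhA⟩, k', hk'⟩ := this
      refine ⟨(h⁻¹, k'), hsub (mk_mem_prod (hUU' hhU) (hAO ?_)), Subtype.ext ?_⟩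
      · rw [mem_preimage, hk']; exact hhA
      · rw [hpv]; simp [hk']
  have hpo : IsOpenMap p := by
    intro N hN
    rw [isOpen_iff_forall_mem_open]
    rintro _ ⟨⟨g, k⟩, hgk, rfl⟩
    obtain ⟨A, hA, U, hU, h5, h6⟩ := hbasis N hN g k hgk
    exact ⟨_, fun w hw => h6 w hw, hopen A hA U (isOpen_of_mem_countableBasis hU), h5⟩
  have hpq : IsOpenQuotientMap p := ⟨hps, hpc, hpo⟩
  haveI : BaireSpace T := hpq.baireSpace
  have hval : Continuous (fun z : T => (z : Z)) := by
    rw [hpq.isQuotientMap.continuous_iff]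
    change Continuous fun a : G × K => a.1 • q a.2
    fun_prop
  have hvorb : ∀ y : T, MulAction.orbit V y = (fun z : T => (z : Z)) ⁻¹' MulAction.orbit V (y : Z) := by
    intro y
    ext z
    simp only [MulAction.mem_orbit_iff, mem_preimage]
    constructor
    · rintro ⟨v, rfl⟩; exact ⟨v, rfl⟩
    · rintro ⟨v, hv⟩; exact ⟨v, Subtype.ext hv⟩
  have hBP : ∀ y : T, BaireMeasurableSet (MulAction.orbit V y) := by
    intro y
    letI : MeasurableSpace T := borel T
    haveI : BorelSpace T := ⟨rfl⟩
    apply MeasurableSet.baireMeasurableSet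
    rw [hvorb]
    refine hval.measurable (bk_Vorbit_meas V hV _ ?_)
    rw [MulAction.orbit_eq_iff.2 y.2]
    exact horb
  have := bk_orbit_closed (T := T) V hV hBP ⟨x, hx⟩ ⟨y, hy⟩ ?_
  · rw [hvorb] at this
    exact this
  · intro O hO hyO
    obtain ⟨⟨g, k⟩, hgk⟩ := hps ⟨y, hy⟩
    have hyv : g • q k = y := congrArg Subtype.val hgk
    obtain ⟨A, hA, U, hU, h5, h6⟩ := hbasis (p ⁻¹' O) (hO.preimage hpc) g k
      (by rw [mem_preimage, hgk]; exact hyO)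
    rw [hyv] at h5
    have h7 := hxy A hA U hU (bkV_mono (subset_mul_left U V.one_mem) h5)
    have hUV : U * (V : Set G) = ⋃ v : V, (fun k => k * (v : G)⁻¹) ⁻¹' U := by
      ext h
      simp only [Set.mem_mul, mem_iUnion, mem_preimage, SetLike.mem_coe, Subtype.exists, exists_prop]
      constructor
      · rintro ⟨u, hu, v, hv, rfl⟩
        exact ⟨v, hv, by simpa using hu⟩
      · rintro ⟨v, hv, hu⟩
        exact ⟨_, hu, v, hv, by simp⟩
    rw [hUV, bkV_iUnion _ _ (fun v => (isOpen_of_mem_countableBasis hU).preimage (by fun_prop))] at h7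
    obtain ⟨v, hv⟩ := mem_iUnion.1 h7
    rw [← bkV_smul] at hv
    refine ⟨v, v.2, ?_⟩
    obtain ⟨a, ha, ha'⟩ := h6 ((v : G) • (⟨x, hx⟩ : T)) hv
    rw [← ha']
    exact ha

lemma bk_clopen_family {Z : Type*} (t : TopologicalSpace Z) (ht : @PolishSpace Z t)
    (F : Set (Set Z)) (hF : F.Countable) (hm : ∀ A ∈ F, @MeasurableSet Z (@borel Z t) A) :
    ∃ t' : TopologicalSpace Z, t' ≤ t ∧ @PolishSpace Z t' ∧
      ∀ A ∈ F, IsOpen[t'] A ∧ IsClosed[t'] A := by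
  letI := t
  haveI := ht
  letI : MeasurableSpace Z := borel Z
  haveI : BorelSpace Z := ⟨rfl⟩
  have h : ∀ A : F, ∃ t' : TopologicalSpace Z, t' ≤ t ∧ @PolishSpace Z t' ∧
      IsClosed[t'] (A : Set Z) ∧ IsOpen[t'] (A : Set Z) := fun A => (hm A A.2).isClopenable
  choose m h1 h2 h3 h4 using h
  haveI := hF.to_subtype
  obtain ⟨t', h5, h6, h7⟩ := PolishSpace.exists_polishSpace_forall_le (t := t) m h1 h2
  exact ⟨t', h6, h7, fun A hA => ⟨h5 ⟨A, hA⟩ _ (h4 ⟨A, hA⟩), (h3 ⟨A, hA⟩).mono (h5 ⟨A, hA⟩)⟩⟩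

lemma bk_topology {Z : Type*} [t0 : TopologicalSpace Z] [PolishSpace Z] [MeasurableSpace Z]
    [BorelSpace Z] [MulAction G Z] [ContinuousSMul G Z] (S : Set Z) (hS : MeasurableSet S) :
    ∃ (t : {t : TopologicalSpace Z // t ≤ t0 ∧ @PolishSpace Z t}) (B : Set (Set Z)),
      IsClosed[t.1] S ∧
      B.Countable ∧ (∀ A ∈ B, IsOpen[t.1] A ∧ MeasurableSet A) ∧
      (∀ O : Set Z, IsOpen[t.1] O → ∀ z ∈ O, ∃ A ∈ B, z ∈ A ∧ A ⊆ O) ∧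
      (∀ A ∈ B, ∀ U ∈ countableBasis G, IsOpen[t.1] (bkV A U) ∧ IsClosed[t.1] (bkV A U)) := by
  let PT := {t : TopologicalSpace Z // t ≤ t0 ∧ @PolishSpace Z t}
  have hbor : ∀ t : PT, @borel Z t.1 = ‹MeasurableSpace Z› := by
    intro t
    rw [BorelSpace.measurable_eq (α := Z)]
    exact borel_eq_borel_of_le t.2.2 ‹_› t.2.1
  let bas : PT → Set (Set Z) := fun t =>
    haveI := t.2.2
    @countableBasis Z t.1 inferInstance
  have bas_c : ∀ t, (bas t).Countable := fun t => by
    letI := t.1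
    haveI := t.2.2
    exact countable_countableBasis Z
  have bas_o : ∀ t, ∀ A ∈ bas t, IsOpen[t.1] A := fun t A hA => by
    letI := t.1
    haveI := t.2.2
    exact isOpen_of_mem_countableBasis hA
  have bas_b : ∀ t : PT, ∀ z : Z, ∀ O ∈ @nhds Z t.1 z, ∃ A ∈ bas t, z ∈ A ∧ A ⊆ O :=
      fun t z O hO => by
    letI := t.1
    haveI := t.2.2
    exact (isBasis_countableBasis Z).mem_nhds_iff.1 hO
  have bas_m : ∀ t, ∀ A ∈ bas t, MeasurableSet A := fun t A hA => by
    rw [← hbor t]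
    exact MeasurableSpace.measurableSet_generateFrom (bas_o t A hA)
  have step : ∀ t : PT, ∃ t' : PT, t'.1 ≤ t.1 ∧ ∀ A ∈ bas t, ∀ U ∈ countableBasis G,
      IsOpen[t'.1] (bkV A U) ∧ IsClosed[t'.1] (bkV A U) := by
    intro t
    obtain ⟨t', h1, h2, h3⟩ := bk_clopen_family t.1 t.2.2
      ((fun a : Set Z × Set G => bkV a.1 a.2) '' (bas t ×ˢ countableBasis G))
      (((bas_c t).prod (countable_countableBasis G)).image _) (by
        rintro _ ⟨⟨A, U⟩, ⟨hA, hU⟩, rfl⟩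
        rw [hbor t]
        exact bkV_measurable (bas_m t A hA) U (isOpen_of_mem_countableBasis hU))
    exact ⟨⟨t', h1.trans t.2.1, h2⟩, h1, fun A hA U hU => h3 _ ⟨(A, U), ⟨hA, hU⟩, rfl⟩⟩
  choose nxt nxt_le nxt_c using step
  obtain ⟨t1, h1, h2, h3⟩ := bk_clopen_family t0 ‹_› {S} (countable_singleton S) (by
    rintro A rfl
    rw [← BorelSpace.measurable_eq (α := Z)]
    exact hS)
  let seq : ℕ → PT := fun n => nxt^[n] ⟨t1, h1, h2⟩
  have seq_succ : ∀ n, seq (n + 1) = nxt (seq n) := fun n => Function.iterate_succ_apply' _ _ _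
  have anti : Antitone fun n => (seq n).1 := antitone_nat_of_succ_le fun n => by
    rw [seq_succ]; exact nxt_le _
  let tt : TopologicalSpace Z := ⨅ n, (seq n).1
  have tt_le : ∀ n, tt ≤ (seq n).1 := fun n => iInf_le _ n
  refine ⟨⟨tt, (tt_le 0).trans h1, ?_⟩, ⋃ n, bas (seq n), ?_, countable_iUnion fun n => bas_c _,
    ?_, ?_, ?_⟩
  · exact PolishSpace.iInf ⟨0, fun n => anti (Nat.zero_le n)⟩ fun n => (seq n).2.2
  · exact (h3 S rfl).2.mono (tt_le 0)
  · intro A hA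
    obtain ⟨n, hn⟩ := mem_iUnion.1 hA
    exact ⟨tt_le n _ (bas_o _ A hn), bas_m _ A hn⟩
  · intro O hO z hz
    have hnh : O ∈ @nhds Z tt z := by
      letI := tt
      exact hO.mem_nhds hz
    rw [nhds_iInf] at hnh
    rw [mem_iInf_of_directed] at hnh
    · obtain ⟨n, hn⟩ := hnh
      obtain ⟨A, hA, h⟩ := bas_b _ _ _ hn
      exact ⟨A, mem_iUnion.2 ⟨n, hA⟩, h⟩
    · apply directed_of_isDirected_le
      intro m n hmn
      exact nhds_mono (anti hmn)
  · intro A hA U hU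
    obtain ⟨n, hn⟩ := mem_iUnion.1 hA
    have := nxt_c _ A hn U hU
    rw [← seq_succ] at this
    exact ⟨tt_le _ _ this.1, this.2.mono (tt_le _)⟩

lemma bk_separate {Z X : Type*} [t0 : TopologicalSpace Z] [PolishSpace Z] [MeasurableSpace Z]
    [BorelSpace Z] [MulAction G Z] [ContinuousSMul G Z] [TopologicalSpace X] [T1Space X]
    (V : Subgroup G) (hV : IsOpen (V : Set G)) (S : Set Z) (hS : MeasurableSet S)
    (f : Z → X) (hf : Continuous f)
    (horb : ∀ z ∈ S, MulAction.orbit G z = S ∩ f ⁻¹' {f z}) :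
    ∃ W : Set (Set Z), W.Countable ∧ (∀ A ∈ W, MeasurableSet A) ∧
      (∀ A ∈ W, ∀ v ∈ V, ∀ z, v • z ∈ A ↔ z ∈ A) ∧
      ∀ x ∈ S, ∀ y ∈ S, f x = f y → (∀ A ∈ W, y ∈ A → x ∈ A) → y ∈ MulAction.orbit V x := by
  obtain ⟨t, B, hSc, hBc, hBo, hBb, hBV⟩ := bk_topology (G := G) S hS
  have hUV : ∀ U ∈ countableBasis G, IsOpen (U * (V : Set G)) := fun U hU =>
    (isOpen_of_mem_countableBasis hU).mul_right
  refine ⟨(fun a : Set Z × Set G => bkV a.1 (a.2 * (V : Set G))) '' (B ×ˢ countableBasis G),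
    (hBc.prod (countable_countableBasis G)).image _, ?_, ?_, ?_⟩
  · rintro _ ⟨⟨A, U⟩, ⟨hA, hU⟩, rfl⟩
    exact bkV_measurable (hBo A hA).2 _ (hUV U hU)
  · rintro _ ⟨⟨A, U⟩, ⟨hA, hU⟩, rfl⟩ v hv z
    dsimp only
    rw [bkV_smul]
    have : (fun k => k * v⁻¹) ⁻¹' (U * (V : Set G)) = U * (V : Set G) := by
      ext k
      simp only [mem_preimage, Set.mem_mul, SetLike.mem_coe]
      constructor
      · rintro ⟨u, hu, w, hw, h⟩
        exact ⟨u, hu, w * v, V.mul_mem hw hv, by rw [← mul_assoc, h]; simp⟩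
      · rintro ⟨u, hu, w, hw, rfl⟩
        exact ⟨u, hu, w * v⁻¹, V.mul_mem hw (V.inv_mem hv), by rw [mul_assoc]⟩
    rw [this]
  intro x hx y hy hxy hW
  let Q : Set Z := ⋂ A ∈ B, ⋂ U ∈ {U | U ∈ countableBasis G ∧ (1 : G) ∈ U}, (Aᶜ ∪ bkV A U)
  let K : Set Z := Q ∩ (S ∩ f ⁻¹' {f x})
  have hKc : IsClosed[t.1] K := by
    have hfc : IsClosed[t.1] (f ⁻¹' {f x}) := (isClosed_singleton.preimage hf).mono t.2.1
    letI := t.1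
    refine IsClosed.inter ?_ (IsClosed.inter hSc hfc)
    refine isClosed_biInter fun A hA => isClosed_biInter fun U hU => ?_
    exact ((hBo A hA).1.isClosed_compl).union (hBV A hA U hU.1).2
  have hVo : ∀ A ∈ B, ∀ U : Set G, IsOpen U → IsOpen[t.1] (bkV A U) := by
    intro A hA U hU
    obtain ⟨C, hC, rfl⟩ := (isBasis_countableBasis G).open_eq_sUnion hU
    rw [sUnion_eq_iUnion, bkV_iUnion _ _ (fun i => isOpen_of_mem_countableBasis (hC i.2))]
    letI := t.1
    exact isOpen_iUnion fun i => (hBV A hA _ (hC i.2)).1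
  letI tK : TopologicalSpace K := @instTopologicalSpaceSubtype Z _ t.1
  haveI : PolishSpace K := @IsClosed.polishSpace Z t.1 t.2.2 K hKc
  have hqt : @Continuous K Z tK t.1 Subtype.val := @continuous_subtype_val Z t.1 _
  refine bk_core (K := K) V hV x ?_ Subtype.val (continuous_le_rng t.2.1 hqt) ?_ B ?_ ?_ ?_ ?_ x y
    (MulAction.mem_orbit_self x) ?_ ?_
  · rw [horb x hx]
    exact hS.inter (isClosed_singleton.preimage hf).measurableSet
  · intro k
    rw [horb x hx]
    exact k.2.2
  · intro k O hO hk
    obtain ⟨O', hO', rfl⟩ := (@isOpen_induced_iff _ _ t.1 _ _).1 hO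
    obtain ⟨A, hA, h1, h2⟩ := hBb O' hO' k hk
    exact ⟨A, hA, h1, fun z hz => h2 hz⟩
  · intro k A hA hkA U hU h1
    obtain ⟨U', hU', h1', hsub⟩ := (isBasis_countableBasis G).exists_subset_of_mem_open h1 hU
    have := mem_iInter₂.1 (mem_iInter₂.1 k.2.1 A hA) U' ⟨hU', h1'⟩
    rcases this with h | h
    · exact absurd hkA h
    · exact bkV_mono hsub h
  · intro z hz
    have hQ : ∀ᶠ g in residual G, g • z ∈ Q := by
      have : ∀ A ∈ B, ∀ U ∈ {U | U ∈ countableBasis G ∧ (1 : G) ∈ U},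
          ∀ᶠ g in residual G, g • z ∈ Aᶜ ∪ bkV A U := by
        intro A hA U hU
        borelize G
        have hBP : BaireMeasurableSet {g : G | g • z ∈ A} :=
          MeasurableSet.baireMeasurableSet
            ((by fun_prop : Continuous fun g : G => g • z).measurable (hBo A hA).2)
        obtain ⟨O, hO, hSO⟩ := hBP.residualEq_isOpen
        filter_upwards [hSO] with g hg
        by_cases hgA : g • z ∈ A
        · right
          have hgO : g ∈ O := (show (g • z ∈ A) = (g ∈ O) from hg) ▸ hgA
          rw [bkV_smul]
          intro hcon
          have hop : IsOpen ((fun k => k * g⁻¹) ⁻¹' U) :=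
            (isOpen_of_mem_countableBasis hU.1).preimage (by fun_prop)
          refine not_isMeagre_of_isOpen (hop.inter hO) ⟨g, by simpa using hU.2, hgO⟩ ?_
          unfold IsMeagre at hcon ⊢
          filter_upwards [hSO, hcon] with k hk hk'
          rintro ⟨h1, h2⟩
          exact hk' ⟨h1, (show (k • z ∈ A) = (k ∈ O) from hk) ▸ h2⟩
        · exact Or.inl hgA
      have h2 : ∀ᶠ g in residual G, ∀ A ∈ B, ∀ U ∈ {U | U ∈ countableBasis G ∧ (1 : G) ∈ U},
          g • z ∈ Aᶜ ∪ bkV A U := by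
        rw [eventually_countable_ball hBc]
        intro A hA
        rw [eventually_countable_ball ((countable_countableBasis G).mono fun U hU => hU.1)]
        exact this A hA
      filter_upwards [h2] with g hg
      exact mem_iInter₂.2 fun A hA => mem_iInter₂.2 fun U hU => hg A hA U hU
    filter_upwards [hQ] with g hg
    refine ⟨⟨g • z, hg, ?_⟩, rfl⟩
    rw [← horb x hx]
    exact MulAction.mem_orbit_of_mem_orbit g hz
  · intro A hA U hU
    have := hVo A hA U hU
    exact @IsOpen.preimage _ _ tK t.1 _ hqt _ this
  · rw [horb x hx]
    exact ⟨hy, hxy.symm⟩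
  · intro A hA U hU
    exact hW _ ⟨(A, U), ⟨hA, hU⟩, rfl⟩

/-- The product `Y × X` with `G` acting on the second coordinate only. -/
structure BkPair (Y X : Type*) where
  pr : Y × X

instance bkPairTop {Y X : Type*} [TopologicalSpace Y] [TopologicalSpace X] :
    TopologicalSpace (BkPair Y X) := TopologicalSpace.induced BkPair.pr inferInstance

/-- The canonical homeomorphism. -/
def bkPairHomeo (Y X : Type*) [TopologicalSpace Y] [TopologicalSpace X] : BkPair Y X ≃ₜ Y × X where
  toFun := BkPair.pr
  invFun := BkPair.mk
  left_inv _ := rfl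
  right_inv _ := rfl
  continuous_toFun := continuous_induced_dom
  continuous_invFun := continuous_induced_rng.2 continuous_id

instance bkPairAct {Y X : Type*} [MulAction G X] : MulAction G (BkPair Y X) where
  smul g p := ⟨(p.pr.1, g • p.pr.2)⟩
  one_smul p := by
    change BkPair.mk (p.pr.1, (1 : G) • p.pr.2) = p
    rw [one_smul]
  mul_smul g h p := by
    change BkPair.mk (p.pr.1, (g * h) • p.pr.2) = BkPair.mk (p.pr.1, g • h • p.pr.2)
    rw [mul_smul]

lemma bkPair_smul {Y X : Type*} [MulAction G X] (g : G) (p : BkPair Y X) :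
    g • p = ⟨(p.pr.1, g • p.pr.2)⟩ := rfl

instance bkPairCont {Y X : Type*} [TopologicalSpace Y] [TopologicalSpace X] [MulAction G X]
    [ContinuousSMul G X] : ContinuousSMul G (BkPair Y X) where
  continuous_smul := by
    refine (bkPairHomeo Y X).symm.continuous.comp
      (g := fun q : Y × X => BkPair.mk q)
      (f := fun q : G × BkPair Y X => (q.2.pr.1, q.1 • q.2.pr.2)) ?_
    have h : Continuous (fun q : G × BkPair Y X => q.2.pr) :=
      (bkPairHomeo Y X).continuous.comp continuous_snd
    exact (continuous_fst.comp h).prodMk (continuous_fst.smul (continuous_snd.comp h))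

lemma bk_EV {X : Type*} [TopologicalSpace X] [PolishSpace X] [MeasurableSpace X]
    [BorelSpace X] [MulAction G X] [ContinuousSMul G X]
    (hE : MeasurableSet {p : X × X | ∃ g : G, g • p.1 = p.2})
    (V : Subgroup G) (hV : IsOpen (V : Set G)) :
    MeasurableSet {p : X × X | ∃ g ∈ V, g • p.1 = p.2} := by
  let e := bkPairHomeo X X
  haveI : PolishSpace (BkPair X X) := e.isClosedEmbedding.polishSpace
  letI : MeasurableSpace (BkPair X X) := borel _
  haveI : BorelSpace (BkPair X X) := ⟨rfl⟩
  let S : Set (BkPair X X) := e ⁻¹' {p : X × X | ∃ g : G, g • p.1 = p.2}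
  have hS : MeasurableSet S := e.continuous.measurable hE
  obtain ⟨W, hWc, hWm, hWi, hW⟩ := bk_separate V hV S hS (fun z => z.pr.1)
    (continuous_fst.comp e.continuous) (by
      rintro ⟨x, y⟩ ⟨g, hg⟩
      change g • x = y at hg
      ext ⟨x', y'⟩
      constructor
      · rintro ⟨h, hh⟩
        change BkPair.mk (x, h • y) = BkPair.mk (x', y') at hh
        rw [BkPair.mk.injEq, Prod.mk.injEq] at hh
        obtain ⟨rfl, rfl⟩ := hh
        refine ⟨⟨h * g, ?_⟩, rfl⟩
        change (h * g) • x = h • y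
        rw [mul_smul, hg]
      · rintro ⟨⟨h, hh⟩, hx⟩
        change h • x' = y' at hh
        change x' = x at hx
        subst hx
        refine ⟨h * g⁻¹, ?_⟩
        change BkPair.mk (x', (h * g⁻¹) • y) = BkPair.mk (x', y')
        rw [← hg, ← hh, mul_smul, inv_smul_smul])
  have key : {p : X × X | ∃ g ∈ V, g • p.1 = p.2} =
      {p : X × X | ∃ g : G, g • p.1 = p.2} ∩
        ⋂ A ∈ W, ((fun p : X × X => BkPair.mk p) ⁻¹' A)ᶜ ∪
          (fun p : X × X => BkPair.mk (p.1, p.1)) ⁻¹' A := by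
    ext ⟨x, y⟩
    simp only [mem_inter_iff, mem_iInter, mem_union, mem_compl_iff, mem_preimage]
    constructor
    · rintro ⟨v, hv, hvx⟩
      change v • x = y at hvx
      refine ⟨⟨v, hvx⟩, fun A hA => ?_⟩
      have := hWi A hA v hv ⟨(x, x)⟩
      rw [bkPair_smul] at this
      simp only [hvx] at this
      tauto
    · rintro ⟨⟨g, hg⟩, h⟩
      have := hW ⟨(x, x)⟩ ⟨1, one_smul _ _⟩ ⟨(x, y)⟩ ⟨g, hg⟩ rfl
        (fun A hA hy => (h A hA).resolve_left (fun hn => hn hy))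
      obtain ⟨v, hv⟩ := this
      refine ⟨v, v.2, ?_⟩
      change BkPair.mk (x, (v : G) • x) = BkPair.mk (x, y) at hv
      rw [BkPair.mk.injEq, Prod.mk.injEq] at hv
      exact hv.2
  rw [key]
  refine hE.inter (MeasurableSet.biInter hWc fun A hA => ?_)
  refine MeasurableSet.union ?_ ?_
  · exact (e.symm.continuous.measurable (hWm A hA)).compl
  · exact (e.symm.continuous.comp (continuous_fst.prodMk continuous_fst)).measurable (hWm A hA)

lemma bk_forward {X : Type*} [TopologicalSpace X] [PolishSpace X] [MeasurableSpace X]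
    [BorelSpace X] [MulAction G X] [ContinuousSMul G X]
    (hE : MeasurableSet {p : X × X | ∃ g : G, g • p.1 = p.2})
    (hbas : ∀ U : Set G, IsOpen U → (1 : G) ∈ U →
      ∃ V : Subgroup G, IsOpen (V : Set G) ∧ (V : Set G) ⊆ U)
    (U : Set G) (hU : IsOpen U) :
    MeasurableSet {x : X | ∃ g ∈ U, g • x = x} := by
  have h1 : ∀ k : U, ∃ V : Subgroup G, IsOpen (V : Set G) ∧
      (V : Set G) ⊆ (fun g => k.1 * g) ⁻¹' U := fun k =>
    hbas _ (hU.preimage (continuous_const_mul k.1)) (by simp)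
  choose V hVo hVU using h1
  obtain ⟨T, hTc, hT⟩ := TopologicalSpace.isOpen_iUnion_countable
    (fun k : U => (fun g => k.1⁻¹ * g) ⁻¹' (V k : Set G))
    (fun k => (hVo k).preimage (continuous_const_mul _))
  have key : {x : X | ∃ g ∈ U, g • x = x} =
      ⋃ k ∈ T, (fun x : X => (x, k.1⁻¹ • x)) ⁻¹' {p : X × X | ∃ g ∈ V k, g • p.1 = p.2} := by
    ext x
    simp only [mem_iUnion, mem_preimage]
    constructor
    · rintro ⟨g, hg, hgx⟩
      have : g ∈ ⋃ k : U, (fun g => k.1⁻¹ * g) ⁻¹' (V k : Set G) := by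
        refine mem_iUnion.2 ⟨⟨g, hg⟩, ?_⟩
        simp [one_mem]
      rw [← hT] at this
      simp only [mem_iUnion] at this
      obtain ⟨k, hk, hgk⟩ := this
      refine ⟨k, hk, k.1⁻¹ * g, hgk, ?_⟩
      rw [mul_smul, hgx]
    · rintro ⟨k, hk, g, hg, hgx⟩
      refine ⟨k.1 * g, hVU k hg, ?_⟩
      change g • x = k.1⁻¹ • x at hgx
      rw [mul_smul, hgx, smul_inv_smul]
  rw [key]
  refine MeasurableSet.biUnion hTc fun k hk => ?_
  exact (continuous_id.prodMk (continuous_const_smul _)).measurable (bk_EV hE (V k) (hVo k))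

lemma bk_leftmost (C : Set (ℕ → ℕ)) (hC : IsClosed C) (hne : C.Nonempty) :
    ∃ a ∈ C, ∀ b ∈ C, ∀ n, (∀ i < n, b i = a i) → ¬ b n < a n := by
  have step : ∀ (k : ℕ) (x : C), ∃ y : C, (∀ i < k, y.1 i = x.1 i) ∧
      ∀ b ∈ C, (∀ i < k, b i = x.1 i) → y.1 k ≤ b k := by
    intro k x
    classical
    have hex : ∃ m, ∃ y : C, (∀ i < k, y.1 i = x.1 i) ∧ y.1 k = m := ⟨_, x, fun _ _ => rfl, rfl⟩
    obtain ⟨y, hy, hym⟩ := Nat.find_spec hex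
    refine ⟨y, hy, fun b hb hbx => ?_⟩
    rw [hym]
    exact Nat.find_min' hex ⟨⟨b, hb⟩, hbx, rfl⟩
  choose F hF1 hF2 using step
  obtain ⟨x0, hx0⟩ := hne
  let s : ℕ → C := fun n => Nat.rec ⟨x0, hx0⟩ (fun k x => F k x) n
  have hs : ∀ n, s (n + 1) = F n (s n) := fun n => rfl
  let a : ℕ → ℕ := fun k => (s (k + 1)).1 k
  have ha : ∀ m i, i < m → (s m).1 i = a i := by
    intro m
    induction m with
    | zero => intro i hi; omega
    | succ m ih =>
      intro i hi
      rcases Nat.lt_succ_iff_lt_or_eq.1 hi with h | rfl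
      · rw [hs, hF1 m (s m) i h, ih i h]
      · rfl
  refine ⟨a, ?_, ?_⟩
  · refine hC.mem_of_tendsto (f := fun m => (s m).1) (b := atTop) ?_
      (Eventually.of_forall fun m => (s m).2)
    rw [tendsto_pi_nhds]
    intro i
    refine tendsto_const_nhds.congr' ?_
    filter_upwards [eventually_gt_atTop i] with m hm
    exact (ha m i hm).symm
  · intro b hb n hbn
    have := hF2 n (s n) b hb (fun i hi => by rw [hbn i hi, ha n i hi])
    rw [not_lt]
    exact this

lemma bk_backward {X : Type*} [TopologicalSpace X] [PolishSpace X] [MeasurableSpace X]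
    [BorelSpace X] [MulAction G X] [ContinuousSMul G X]
    (c : G → ℕ → ℕ) (hc : IsClosedEmbedding c)
    (hm : ∀ U : Set G, IsOpen U → MeasurableSet {x : X | ∃ g ∈ U, g • x = x}) :
    MeasurableSet {p : X × X | ∃ g : G, g • p.1 = p.2} := by
  letI : MeasurableSpace G := borel G
  haveI : BorelSpace G := ⟨rfl⟩
  -- projection lemma
  have hproj : ∀ W : Set (G × G), IsOpen W →
      MeasurableSet {p : X × G | ∃ h, h • p.1 = p.1 ∧ (h, p.2) ∈ W} := by
    intro W hW
    let B := countableBasis G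
    have hB : IsTopologicalBasis B := isBasis_countableBasis G
    have key : {p : X × G | ∃ h, h • p.1 = p.1 ∧ (h, p.2) ∈ W} =
        ⋃ q ∈ {q : Set G × Set G | (q.1 ∈ B ∧ q.2 ∈ B) ∧ q.1 ×ˢ q.2 ⊆ W},
          {x : X | ∃ g ∈ q.1, g • x = x} ×ˢ q.2 := by
      ext ⟨x, y⟩
      simp only [mem_iUnion]
      constructor
      · rintro ⟨h, hx, hhW⟩
        obtain ⟨u, v, hu, hv, hhu, hyv, huv⟩ := isOpen_prod_iff.1 hW h y hhW
        obtain ⟨u', hu'B, hu', hu'u⟩ := hB.exists_subset_of_mem_open hhu hu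
        obtain ⟨v', hv'B, hv', hv'v⟩ := hB.exists_subset_of_mem_open hyv hv
        exact ⟨(u', v'), ⟨⟨hu'B, hv'B⟩, (prod_mono hu'u hv'v).trans huv⟩, ⟨h, hu', hx⟩, hv'⟩
      · rintro ⟨⟨u, v⟩, ⟨-, huv⟩, ⟨g, hgu, hgx⟩, hyv⟩
        exact ⟨g, hgx, huv ⟨hgu, hyv⟩⟩
    rw [key]
    refine MeasurableSet.biUnion ?_ ?_
    · exact (((countable_countableBasis G).prod (countable_countableBasis G))).mono
        (fun q hq => hq.1)
    · rintro ⟨u, v⟩ ⟨⟨hu, hv⟩, -⟩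
      exact (hm u (isOpen_of_mem_countableBasis hu)).prod
        (isOpen_of_mem_countableBasis hv).measurableSet
  let P : ℕ → Set (G × G) := fun n =>
    {q | (∀ i < n, c (q.2 * q.1) i = c q.2 i) ∧ c (q.2 * q.1) n < c q.2 n}
  have hP : ∀ n, IsOpen (P n) := by
    intro n
    have h1 : ∀ i, Continuous fun q : G × G => c (q.2 * q.1) i := fun i =>
      (continuous_apply i).comp (hc.continuous.comp (continuous_snd.mul continuous_fst))
    have h2 : ∀ i, Continuous fun q : G × G => c q.2 i := fun i =>
      (continuous_apply i).comp (hc.continuous.comp continuous_snd)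
    have : P n = (⋂ i ∈ Iio n, {q | c (q.2 * q.1) i = c q.2 i}) ∩
        {q | c (q.2 * q.1) n < c q.2 n} := by
      ext q; simp [P]
    rw [this]
    refine IsOpen.inter ((finite_Iio n).isOpen_biInter fun i _ => ?_)
      (isOpen_lt (h1 n) (h2 n))
    exact (isOpen_discrete {r : ℕ × ℕ | r.1 = r.2}).preimage ((h1 i).prodMk (h2 i))
  let T : Set (X × G) := ⋂ n, {p : X × G | ∃ h, h • p.1 = p.1 ∧ (h, p.2) ∈ P n}ᶜ
  have hT : MeasurableSet T := MeasurableSet.iInter fun n => (hproj _ (hP n)).compl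
  have hTmem : ∀ x g, (x, g) ∈ T ↔ ∀ n h, h • x = x → (∀ i < n, c (g * h) i = c g i) →
      ¬ c (g * h) n < c g n := by
    intro x g
    simp only [T, P, mem_iInter, mem_compl_iff]
    constructor
    · intro h n k hk h1 h2
      exact h n ⟨k, hk, h1, h2⟩
    · rintro h n ⟨k, hk, h1, h2⟩
      exact h n k hk h1 h2
  let φ : X × G → X × X := fun p => (p.1, p.2 • p.1)
  have hφ : Continuous φ := continuous_fst.prodMk (continuous_snd.smul continuous_fst)
  have hinj : InjOn φ T := by
    rintro ⟨x, g⟩ hg ⟨x', g'⟩ hg' heq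
    rw [Prod.mk.injEq] at heq
    obtain ⟨h1, h2⟩ := heq
    change x = x' at h1
    subst h1
    change g • x = g' • x at h2
    rw [hTmem] at hg hg'
    have e1 : (g⁻¹ * g') • x = x := by rw [mul_smul, ← h2, inv_smul_smul]
    have e2 : (g'⁻¹ * g) • x = x := by rw [mul_smul, h2, inv_smul_smul]
    have : c g = c g' := by
      funext n
      induction n using Nat.strong_induction_on with
      | _ n ih =>
        have a1 := hg n _ e1 (by rw [mul_inv_cancel_left]; exact fun i hi => (ih i hi).symm)
        have a2 := hg' n _ e2 (by rw [mul_inv_cancel_left]; exact fun i hi => ih i hi)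
        rw [mul_inv_cancel_left] at a1 a2
        omega
    rw [hc.injective this]
  have himg : φ '' T = {p : X × X | ∃ g : G, g • p.1 = p.2} := by
    ext ⟨x, y⟩
    constructor
    · rintro ⟨⟨x', g⟩, -, h⟩
      rw [Prod.mk.injEq] at h
      obtain ⟨h1, h2⟩ := h
      change x' = x at h1
      subst h1
      exact ⟨g, h2⟩
    · rintro ⟨g, hg⟩
      change g • x = y at hg
      have hcl : IsClosed {k : G | k • x = y} :=
        isClosed_eq (continuous_id.smul continuous_const) continuous_const
      obtain ⟨_, ⟨k, hk, rfl⟩, hmin⟩ := bk_leftmost (c '' {k : G | k • x = y})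
        (hc.isClosedMap _ hcl) ⟨c g, g, hg, rfl⟩
      change k • x = y at hk
      refine ⟨(x, k), ?_, ?_⟩
      · rw [hTmem]
        intro n h hh h1
        refine hmin _ ⟨k * h, ?_, rfl⟩ n h1
        change (k * h) • x = y
        rw [mul_smul, hh, hk]
      · change (x, k • x) = (x, y)
        rw [hk]
  rw [← himg]
  exact hT.image_of_continuousOn_injOn hφ.continuousOn hinj

end BKgeneral

section BKSinf

open Topology TopologicalSpace

lemma bk_eval {Y : Type*} [TopologicalSpace Y] {a : Y → ℕ → ℕ} {b : Y → ℕ}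
    (ha : Continuous a) (hb : Continuous b) : Continuous fun y => a y (b y) := by
  have : Continuous (fun p : (ℕ → ℕ) × ℕ => p.1 p.2) :=
    continuous_prod_of_discrete_right.2 fun i => continuous_apply i
  exact this.comp (ha.prodMk hb)

lemma bk_coe_cont : Continuous (fun g : Sinf => (g : ℕ → ℕ)) := continuous_induced_dom

lemma bk_inv_cont : Continuous (fun g : Sinf => ((g⁻¹ : Sinf) : ℕ → ℕ)) := by
  refine continuous_pi fun i => ?_
  rw [continuous_discrete_rng]
  intro j
  have : (fun g : Sinf => (g⁻¹ : Sinf) i) ⁻¹' {j} = (fun g : Sinf => g j) ⁻¹' {i} := by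
    ext g
    simp only [mem_preimage, mem_singleton_iff]
    rw [Equiv.Perm.inv_eq_iff_eq]
    exact eq_comm
  rw [this]
  exact (isOpen_discrete _).preimage ((continuous_apply j).comp bk_coe_cont)

instance bkSinfGroup : IsTopologicalGroup Sinf where
  continuous_mul := continuous_induced_rng.2 <| continuous_pi fun i =>
    bk_eval (a := fun p : Sinf × Sinf => (p.1 : ℕ → ℕ)) (b := fun p => p.2 i)
      (bk_coe_cont.comp continuous_fst)
      ((continuous_apply i).comp (bk_coe_cont.comp continuous_snd))
  continuous_inv := continuous_induced_rng.2 bk_inv_cont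

lemma bk_pair_emb :
    IsClosedEmbedding (fun g : Sinf => ((g : ℕ → ℕ), ((g⁻¹ : Sinf) : ℕ → ℕ))) := by
  have hcont := bk_coe_cont.prodMk bk_inv_cont
  refine ⟨⟨IsInducing.of_comp hcont continuous_fst ⟨rfl⟩, ?_⟩, ?_⟩
  · intro g h hgh
    exact DFunLike.coe_injective (congrArg Prod.fst hgh)
  · have : range (fun g : Sinf => ((g : ℕ → ℕ), ((g⁻¹ : Sinf) : ℕ → ℕ))) =
        ⋂ i, {p : (ℕ → ℕ) × (ℕ → ℕ) | p.1 (p.2 i) = i} ∩ {p | p.2 (p.1 i) = i} := by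
      ext ⟨a, b⟩
      simp only [mem_iInter, mem_range]
      constructor
      · rintro ⟨g, hg⟩ i
        rw [Prod.mk.injEq] at hg
        obtain ⟨rfl, rfl⟩ := hg
        exact ⟨Equiv.apply_symm_apply g i, Equiv.symm_apply_apply g i⟩
      · intro h
        exact ⟨⟨a, b, fun i => (h i).2, fun i => (h i).1⟩, rfl⟩
    rw [this]
    refine isClosed_iInter fun i => IsClosed.inter ?_ ?_
    · exact isClosed_eq (bk_eval continuous_fst ((continuous_apply i).comp continuous_snd))
        continuous_const
    · exact isClosed_eq (bk_eval continuous_snd ((continuous_apply i).comp continuous_fst))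
        continuous_const

instance bkSinfPolish : PolishSpace Sinf := bk_pair_emb.polishSpace

lemma bk_code : ∃ c : Sinf → ℕ → ℕ, IsClosedEmbedding c :=
  ⟨_, ((Homeomorph.sumArrowHomeomorphProdArrow (ι := ℕ) (ι' := ℕ) (X := ℕ)).symm.trans
    (Homeomorph.piCongrLeft (Y := fun _ => ℕ)
      Equiv.natSumNatEquivNat)).isClosedEmbedding.comp bk_pair_emb⟩

lemma bk_basis (G : Subgroup Sinf) (U : Set G) (hU : IsOpen U) (h1 : (1 : G) ∈ U) :
    ∃ V : Subgroup G, IsOpen (V : Set G) ∧ (V : Set G) ⊆ U := by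
  obtain ⟨U', hU', rfl⟩ := isOpen_induced_iff.1 hU
  obtain ⟨U'', hU'', rfl⟩ := isOpen_induced_iff.1 hU'
  obtain ⟨I, u, hu, hIu⟩ := isOpen_pi_iff.1 hU'' _ h1
  let V : Subgroup G :=
    { carrier := {g | ∀ i ∈ I, (g : Sinf) i = i}
      one_mem' := fun i _ => rfl
      mul_mem' := by
        intro g h hg hh i hi
        change (g : Sinf) ((h : Sinf) i) = i
        rw [hh i hi, hg i hi]
      inv_mem' := by
        intro g hg i hi
        change ((g : Sinf)⁻¹ : Sinf) i = i
        rw [Equiv.Perm.inv_eq_iff_eq, hg i hi] }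
  refine ⟨V, ?_, ?_⟩
  · have : (V : Set G) = ⋂ i ∈ I, {g : G | (g : Sinf) i = i} := by
      ext g
      simp only [mem_iInter]
      rfl
    rw [this]
    refine isOpen_biInter_finset fun i _ => ?_
    exact (isOpen_discrete {i}).preimage
      ((continuous_apply i).comp (bk_coe_cont.comp continuous_subtype_val))
  · intro g hg
    refine hIu fun i hi => ?_
    have h2 : (g : Sinf) i = i := hg i hi
    change (g : Sinf) i ∈ u i
    rw [h2]
    exact (hu i hi).2

end BKSinf

/-- Becker–Kechris criterion for closed permutation groups. -/
theorem becker_kechris_stabilizer_map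
    (G : Subgroup Sinf) (hGclosed : IsClosed (G : Set Sinf))
    {X : Type*} [TopologicalSpace X] [PolishSpace X] [MulAction G X] [ContinuousSMul G X]
    (hstab : ∀ x : X, IsClosed {g : G | g • x = x}) :
    @MeasurableSet (X × X) (borel (X × X)) {p : X × X | ∃ g : G, g • p.1 = p.2} ↔
    @Measurable X (EffrosSpace G) (borel X) (effrosSigma G)
      (fun x => ⟨{g : G | g • x = x}, hstab x⟩) := by
  haveI : PolishSpace G := hGclosed.polishSpace
  letI : MeasurableSpace X := borel X
  haveI : BorelSpace X := ⟨rfl⟩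
  rw [← (inferInstance : BorelSpace (X × X)).measurable_eq]
  have hset : ∀ U : Set G, (fun x : X => (⟨{g : G | g • x = x}, hstab x⟩ : EffrosSpace G)) ⁻¹'
      {K : EffrosSpace G | (K.1 ∩ U).Nonempty} = {x : X | ∃ g ∈ U, g • x = x} := by
    intro U
    ext x
    constructor
    · rintro ⟨g, hg, hgU⟩
      exact ⟨g, hgU, hg⟩
    · rintro ⟨g, hgU, hg⟩
      exact ⟨g, hg, hgU⟩
  constructor
  · intro hE
    refine measurable_generateFrom ?_
    rintro _ ⟨U, hU, rfl⟩
    have h2 := bk_forward hE (bk_basis G) U hU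
    rw [← hset] at h2
    exact h2
  · intro hm
    obtain ⟨c, hc⟩ := bk_code
    refine bk_backward (fun g : G => c g) (hc.comp hGclosed.isClosedEmbedding_subtypeVal) ?_
    intro U hU
    rw [← hset]
    exact hm (MeasurableSpace.measurableSet_generateFrom ⟨U, hU, rfl⟩)
end
end

section
/- The orbit is the (γ*+2)-set: For every x ∈ X, B_{γ^G_*(x)+2}(x,∅) = G·x, where ∅ denotes the empty partial bijection. Consequently, for every σ ∈ S^G_{<∞}, B_{γ^G_*(x)+2}(x,σ) = V^G_σ·x. -/
open Set Pointwise

noncomputable section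

section Helpers

variable (G : Subgroup Sinf) {X : Type*} [TopologicalSpace X] [MulAction G X]

theorem Bset_zero' (A : ℕ → Set X) (σ : Set (ℕ × ℕ)) (x : X) : Bset G A 0 σ x = univ := by
  unfold Bset
  rw [Ordinal.limitRecOn_zero]

theorem Bset_one' (A : ℕ → Set X) (σ : Set (ℕ × ℕ)) (x : X) :
    Bset G A (0 + 1) σ x = BsetOne G A σ x := by
  unfold Bset
  rw [Ordinal.limitRecOn_add_one, if_pos rfl]

theorem Bset_succ' (A : ℕ → Set X) (o : Ordinal.{0}) (ho : o ≠ 0) (σ : Set (ℕ × ℕ)) (x : X) :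
    Bset G A (o + 1) σ x = BsetSucc G (Bset G A o) σ x := by
  unfold Bset
  rw [Ordinal.limitRecOn_add_one, if_neg ho]

theorem Bset_limit' (A : ℕ → Set X) (o : Ordinal.{0}) (ho : Order.IsSuccLimit o)
    (σ : Set (ℕ × ℕ)) (x : X) :
    Bset G A o σ x = ⋂ β : Ordinal.{0}, ⋂ (_ : β < o), ⋂ (_ : 1 ≤ β), Bset G A β σ x := by
  unfold Bset
  rw [Ordinal.limitRecOn_limit _ _ _ _ ho]

theorem pdom_restr (g : Sinf) (d : Finset ℕ) : pdom (restr g d) = ↑d := by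
  ext k; simp [pdom, restr]

theorem prng_restr (g : Sinf) (d : Finset ℕ) : prng (restr g d) = ↑(d.image g) := by
  ext k
  constructor
  · rintro ⟨⟨a, b⟩, ⟨h1, h2⟩, rfl⟩
    exact Finset.mem_coe.2 (Finset.mem_image.2 ⟨a, h1, h2⟩)
  · intro h
    obtain ⟨a, h1, rfl⟩ := Finset.mem_image.1 (Finset.mem_coe.1 h)
    exact ⟨(a, g a), ⟨h1, rfl⟩, rfl⟩

theorem restr_congr {g g' : Sinf} {d : Finset ℕ} (h : ∀ k ∈ d, g' k = g k) :
    restr g' d = restr g d := by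
  ext ⟨a, b⟩
  simp only [restr, mem_setOf_eq]
  constructor
  · rintro ⟨h1, h2⟩; exact ⟨h1, by rw [← h a h1, h2]⟩
  · rintro ⟨h1, h2⟩; exact ⟨h1, by rw [h a h1, h2]⟩

theorem restr_subset {g g' : Sinf} {d d' : Finset ℕ} :
    restr g d ⊆ restr g' d' ↔ d ⊆ d' ∧ ∀ k ∈ d, g' k = g k := by
  constructor
  · intro h
    constructor
    · intro k hk
      exact (@h (k, g k) ⟨hk, rfl⟩).1
    · intro k hk
      exact (@h (k, g k) ⟨hk, rfl⟩).2
  · rintro ⟨h1, h2⟩ ⟨a, b⟩ ⟨h3, h4⟩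
    refine ⟨h1 h3, ?_⟩
    have := h2 a h3
    simp only at h4 ⊢
    rw [this, h4]

theorem mem_Vb_restr (g k : G) (d : Finset ℕ) :
    k ∈ Vb G (restr g d) ↔ ∀ i ∈ d, (k : Sinf) i = (g : Sinf) i := by
  simp only [Vb, restr, mem_setOf_eq]
  constructor
  · intro h i hi
    exact h (i, (g : Sinf) i) ⟨hi, rfl⟩
  · rintro h ⟨a, b⟩ ⟨h1, h2⟩
    simp only at h1 h2 ⊢
    rw [h a h1, h2]

theorem mem_Vc_restr (g k : G) (d : Finset ℕ) :
    k ∈ Vc G (prng (restr g d)) ↔ ∀ i ∈ d, (k : Sinf) ((g : Sinf) i) = (g : Sinf) i := by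
  rw [prng_restr]
  constructor
  · intro h i hi
    exact h _ (Finset.mem_coe.2 (Finset.mem_image_of_mem _ hi))
  · intro h j hj
    obtain ⟨i, hi, rfl⟩ := Finset.mem_image.1 (Finset.mem_coe.1 hj)
    exact h i hi

theorem Vc_inv {c : Set ℕ} {k : G} (hk : k ∈ Vc G c) : k⁻¹ ∈ Vc G c := by
  intro i hi
  have := hk i hi
  rw [Subgroup.coe_inv, Equiv.Perm.inv_eq_iff_eq, this]

theorem mem_setSmul_Vc (c : Set ℕ) (B : Set X) (y : X) :
    y ∈ setSmul G (Vc G c) B ↔ ∃ k ∈ Vc G c, k • y ∈ B := by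
  simp only [setSmul, mem_iUnion, Set.mem_smul_set_iff_inv_smul_mem, exists_prop]
  constructor
  · rintro ⟨k, hk, h⟩; exact ⟨k⁻¹, Vc_inv G hk, h⟩
  · rintro ⟨k, hk, h⟩; exact ⟨k⁻¹, Vc_inv G hk, by simpa using h⟩

theorem mem_BsetOne (A : ℕ → Set X) (σ : Set (ℕ × ℕ)) (x y : X) :
    y ∈ BsetOne G A σ x ↔
      ∀ l, ((∃ k ∈ Vb G σ, k • x ∈ A l) ↔ ∃ k ∈ Vc G (prng σ), k • y ∈ A l) := by
  have key : ∀ l, (setOrb G (Vb G σ) x ∩ A l).Nonempty ↔ ∃ k ∈ Vb G σ, k • x ∈ A l := by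
    intro l
    constructor
    · rintro ⟨_, ⟨k, hk, rfl⟩, h⟩; exact ⟨k, hk, h⟩
    · rintro ⟨k, hk, h⟩; exact ⟨_, ⟨k, hk, rfl⟩, h⟩
  simp only [BsetOne, mem_inter_iff, mem_iInter, mem_compl_iff, mem_setSmul_Vc,
    ← Set.not_nonempty_iff_eq_empty, key]
  constructor
  · rintro ⟨h1, h2⟩ l
    exact ⟨h1 l, fun h => by_contra fun h' => h2 l h' h⟩
  · intro h
    exact ⟨fun l => (h l).1, fun l h1 h2 => h1 ((h l).2 h2)⟩

theorem mem_BsetOne_open (A : ℕ → Set X)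
    (hbasis : TopologicalSpace.IsTopologicalBasis (Set.range A)) (σ : Set (ℕ × ℕ)) (x y : X) :
    y ∈ BsetOne G A σ x ↔
      ∀ U : Set X, IsOpen U →
        ((∃ k ∈ Vb G σ, k • x ∈ U) ↔ ∃ k ∈ Vc G (prng σ), k • y ∈ U) := by
  rw [mem_BsetOne]
  constructor
  · intro h U hU
    constructor
    · rintro ⟨k, hk, hx⟩
      obtain ⟨_, ⟨l, rfl⟩, h1, h2⟩ := hbasis.exists_subset_of_mem_open hx hU
      obtain ⟨k', hk', h3⟩ := (h l).1 ⟨k, hk, h1⟩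
      exact ⟨k', hk', h2 h3⟩
    · rintro ⟨k, hk, hx⟩
      obtain ⟨_, ⟨l, rfl⟩, h1, h2⟩ := hbasis.exists_subset_of_mem_open hx hU
      obtain ⟨k', hk', h3⟩ := (h l).2 ⟨k, hk, h1⟩
      exact ⟨k', hk', h2 h3⟩
  · intro h l
    exact h _ (hbasis.isOpen ⟨l, rfl⟩)

/-- The `α`-set of `x` at the restriction of `g` to `d`. -/
def BB (A : ℕ → Set X) (x : X) (α : Ordinal.{0}) (g : G) (d : Finset ℕ) : Set X :=
  Bset G A α (restr g d) x

theorem BB_congr (A : ℕ → Set X) (x : X) (α : Ordinal.{0}) {g g' : G} {d : Finset ℕ}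
    (h : ∀ k ∈ d, (g' : Sinf) k = (g : Sinf) k) : BB G A x α g' d = BB G A x α g d := by
  unfold BB
  rw [restr_congr h]

theorem mem_BB_succ (A : ℕ → Set X) (x y : X) (α : Ordinal.{0}) (hα : α ≠ 0) (g : G)
    (d : Finset ℕ) :
    y ∈ BB G A x (α + 1) g d ↔
      (∀ b : Finset ℕ, d ⊆ b → ∃ g' : G, (∀ k ∈ d, (g' : Sinf) k = (g : Sinf) k) ∧
        y ∈ BB G A x α g' b) ∧
      (∀ a : Finset ℕ, d.image (g : Sinf) ⊆ a → ∃ g' : G,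
        (∀ k ∈ d, (g' : Sinf) k = (g : Sinf) k) ∧ ∃ d' : Finset ℕ, d ⊆ d' ∧
        d'.image (g' : Sinf) = a ∧ y ∈ BB G A x α g' d') := by
  unfold BB
  rw [Bset_succ' G A α hα]
  simp only [BsetSucc, mem_inter_iff, mem_iInter, mem_iUnion, pdom_restr, prng_restr,
    Finset.coe_subset, exists_prop]
  refine and_congr (forall_congr' fun b => imp_congr_right fun hb => ?_)
    (forall_congr' fun b => imp_congr_right fun hb => ?_)
  · constructor
    · rintro ⟨_, ⟨g', hg', d', rfl⟩, h1, h2, h3⟩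
      rw [pdom_restr, Finset.coe_inj] at h2
      subst h2
      exact ⟨⟨g', hg'⟩, (restr_subset.1 h1).2, h3⟩
    · rintro ⟨g', h1, h2⟩
      exact ⟨_, ⟨g', g'.2, b, rfl⟩, restr_subset.2 ⟨hb, h1⟩, pdom_restr _ _, h2⟩
  · constructor
    · rintro ⟨_, ⟨g', hg', d', rfl⟩, h1, h2, h3⟩
      rw [prng_restr, Finset.coe_inj] at h2
      exact ⟨⟨g', hg'⟩, (restr_subset.1 h1).2, d', (restr_subset.1 h1).1, h2, h3⟩
    · rintro ⟨g', h1, d', h2, h3, h4⟩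
      exact ⟨_, ⟨g', g'.2, d', rfl⟩, restr_subset.2 ⟨h2, h1⟩, by rw [prng_restr, h3], h4⟩

theorem BB_zero (A : ℕ → Set X) (x : X) (g : G) (d : Finset ℕ) : BB G A x 0 g d = univ :=
  Bset_zero' G A _ x

theorem mem_BB_limit (A : ℕ → Set X) (x y : X) (o : Ordinal.{0}) (ho : Order.IsSuccLimit o)
    (g : G) (d : Finset ℕ) :
    y ∈ BB G A x o g d ↔ ∀ β < o, 1 ≤ β → y ∈ BB G A x β g d := by
  unfold BB
  rw [Bset_limit' G A o ho]
  simp only [mem_iInter]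

theorem mem_BB_one (A : ℕ → Set X)
    (hbasis : TopologicalSpace.IsTopologicalBasis (Set.range A)) (x y : X) (g : G)
    (d : Finset ℕ) :
    y ∈ BB G A x (0 + 1) g d ↔ ∀ U : Set X, IsOpen U →
        ((∃ k : G, (∀ i ∈ d, (k : Sinf) i = (g : Sinf) i) ∧ k • x ∈ U) ↔
          ∃ k : G, (∀ i ∈ d, (k : Sinf) ((g : Sinf) i) = (g : Sinf) i) ∧ k • y ∈ U) := by
  unfold BB
  rw [Bset_one', mem_BsetOne_open G A hbasis]
  simp only [mem_Vb_restr, mem_Vc_restr]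

/-- Equivariance. -/
theorem smul_mem_BB [ContinuousSMul G X] (A : ℕ → Set X)
    (hbasis : TopologicalSpace.IsTopologicalBasis (Set.range A)) (x : X) (α : Ordinal.{0}) :
    ∀ (h g : G) (d : Finset ℕ) (y : X), y ∈ BB G A x α g d → h • y ∈ BB G A x α (h * g) d := by
  induction α using Ordinal.limitRecOn with
  | zero => intro h g d y _; rw [BB_zero]; trivial
  | add_one o ih =>
    intro h g d y hy
    by_cases ho : o = 0
    · subst ho
      rw [mem_BB_one G A hbasis] at hy ⊢
      intro U hU
      have hU' : IsOpen ((fun z : X => h • z) ⁻¹' U) := hU.preimage (continuous_const_smul h)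
      have := hy _ hU'
      constructor
      · rintro ⟨k, hk, hx⟩
        obtain ⟨k', h1, h2⟩ := this.1 ⟨h⁻¹ * k, fun i hi => by simp [hk i hi], by
          simpa [mul_smul] using hx⟩
        refine ⟨h * k' * h⁻¹, fun i hi => by simp [h1 i hi], ?_⟩
        simpa [mul_smul] using h2
      · rintro ⟨k, hk, hx⟩
        obtain ⟨k', h1, h2⟩ := this.2 ⟨h⁻¹ * k * h, fun i hi => by
          have := hk i hi
          simp only [Subgroup.coe_mul, Equiv.Perm.mul_apply] at this
          simp [this], by
          simpa [mul_smul] using hx⟩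
        refine ⟨h * k', fun i hi => by simp [h1 i hi], ?_⟩
        simpa [mul_smul] using h2
    · rw [mem_BB_succ G A x _ o ho] at hy ⊢
      refine ⟨fun b hb => ?_, fun a ha => ?_⟩
      · obtain ⟨g', h1, h2⟩ := hy.1 b hb
        exact ⟨h * g', fun k hk => by simp [h1 k hk], ih h g' b y h2⟩
      · have ha' : d.image (g : Sinf) ⊆ a.image ((h⁻¹ : G) : Sinf) := by
          intro k hk
          obtain ⟨i, hi, rfl⟩ := Finset.mem_image.1 hk
          refine Finset.mem_image.2 ⟨(h : Sinf) ((g : Sinf) i), ha ?_, by simp⟩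
          exact Finset.mem_image.2 ⟨i, hi, by simp⟩
        obtain ⟨g', h1, d', h2, h3, h4⟩ := hy.2 _ ha'
        refine ⟨h * g', fun k hk => by simp [h1 k hk], d', h2, ?_, ih h g' d' y h4⟩
        have : d'.image ((h * g' : G) : Sinf) = (d'.image (g' : Sinf)).image (h : Sinf) := by
          rw [Finset.image_image]; rfl
        rw [this, h3, Finset.image_image]
        refine (Finset.image_congr fun i _ => ?_).trans Finset.image_id
        simp
  | limit o ho ih =>
    intro h g d y hy
    rw [mem_BB_limit G A x _ o ho] at hy ⊢
    intro β hβ h1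
    exact ih β hβ h g d y (hy β hβ h1)

theorem BB_smul_eq [ContinuousSMul G X] (A : ℕ → Set X)
    (hbasis : TopologicalSpace.IsTopologicalBasis (Set.range A)) (x : X) (α : Ordinal.{0})
    (h : G) {g₁ g₂ : G} {d₁ d₂ : Finset ℕ} (he : BB G A x α g₁ d₁ = BB G A x α g₂ d₂) :
    BB G A x α (h * g₁) d₁ = BB G A x α (h * g₂) d₂ := by
  have aux : ∀ {g₁ g₂ : G} {d₁ d₂ : Finset ℕ}, BB G A x α g₁ d₁ = BB G A x α g₂ d₂ →
      BB G A x α (h * g₁) d₁ ⊆ BB G A x α (h * g₂) d₂ := by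
    intro g₁ g₂ d₁ d₂ he y hy
    have h1 := smul_mem_BB G A hbasis x α h⁻¹ _ _ _ hy
    rw [inv_mul_cancel_left, he] at h1
    have h2 := smul_mem_BB G A hbasis x α h _ _ _ h1
    rwa [smul_inv_smul] at h2
  exact (aux he).antisymm (aux he.symm)

/-- Two `α`-sets with the same range are equal or disjoint. -/
theorem BB_subset_of_mem [ContinuousSMul G X] (A : ℕ → Set X)
    (hbasis : TopologicalSpace.IsTopologicalBasis (Set.range A)) (x : X) (α : Ordinal.{0}) :
    ∀ (g e : G) (d b : Finset ℕ), d.image (g : Sinf) = b.image (e : Sinf) →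
      ∀ y, y ∈ BB G A x α g d → y ∈ BB G A x α e b → BB G A x α g d ⊆ BB G A x α e b := by
  induction α using Ordinal.limitRecOn with
  | zero => intro g e d b _ y _ _; rw [BB_zero, BB_zero]
  | add_one o ih =>
    have ihe : ∀ (g e : G) (d b : Finset ℕ), d.image (g : Sinf) = b.image (e : Sinf) →
      ∀ y, y ∈ BB G A x o g d → y ∈ BB G A x o e b → BB G A x o g d = BB G A x o e b :=
      fun g e d b hr y h1 h2 =>
        (ih g e d b hr y h1 h2).antisymm (ih e g b d hr.symm y h2 h1)
    intro g e d b hr y hg he z hz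
    by_cases ho : o = 0
    · subst ho
      have hfix : ∀ k : G, (∀ i ∈ d, (k : Sinf) ((g : Sinf) i) = (g : Sinf) i) ↔
          (∀ i ∈ b, (k : Sinf) ((e : Sinf) i) = (e : Sinf) i) := by
        intro k
        have h1 : ∀ (g : G) (d : Finset ℕ),
            (∀ i ∈ d, (k : Sinf) ((g : Sinf) i) = (g : Sinf) i) ↔
            ∀ j ∈ d.image (g : Sinf), (k : Sinf) j = j := by
          intro g d; simp
        rw [h1, h1, hr]
      rw [mem_BB_one G A hbasis] at hg he hz ⊢
      simp only [hfix] at hg hz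
      intro U hU
      rw [he U hU, ← hg U hU, hz U hU]
    · rw [mem_BB_succ G A x _ o ho] at hg he hz ⊢
      -- a group element fixing the range also fixes the range of `e` on `b`
      have hfixe : ∀ h : G, (∀ i ∈ d, (h : Sinf) ((g : Sinf) i) = (g : Sinf) i) →
          ∀ i ∈ b, (h : Sinf) ((e : Sinf) i) = (e : Sinf) i := by
        intro h hh i hi
        have : (e : Sinf) i ∈ d.image (g : Sinf) := by
          rw [hr]; exact Finset.mem_image_of_mem _ hi
        obtain ⟨j, hj, hj'⟩ := Finset.mem_image.1 this
        rw [← hj']; exact hh j hj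
      refine ⟨fun b' hb' => ?_, fun a ha => ?_⟩
      · obtain ⟨e₂, h1, h2⟩ := he.1 b' hb'
        have hra : d.image (g : Sinf) ⊆ b'.image (e₂ : Sinf) := by
          rw [hr]
          intro k hk
          obtain ⟨i, hi, rfl⟩ := Finset.mem_image.1 hk
          exact Finset.mem_image.2 ⟨i, hb' hi, h1 i hi⟩
        obtain ⟨g₂, h3, d₂, h4, h5, h6⟩ := hg.2 _ hra
        have hE := ihe g₂ e₂ d₂ b' h5 y h6 h2
        obtain ⟨g₃, h7, h8⟩ := hz.1 d₂ h4
        have hE' := BB_smul_eq G A hbasis x o (g₃ * g₂⁻¹) hE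
        rw [inv_mul_cancel_right] at hE'
        rw [hE'] at h8
        refine ⟨_, ?_, h8⟩
        intro k hk
        rw [Subgroup.coe_mul, Equiv.Perm.mul_apply, h1 k hk]
        refine hfixe _ ?_ k hk
        intro i hi
        have hinv : (g₂ : Sinf).symm ((g : Sinf) i) = i := by
          rw [← h3 i hi, Equiv.symm_apply_apply]
        simp [hinv, h7 i hi]
      · rw [← hr] at ha
        obtain ⟨g₁, h1, d₁, h2, h3, h4⟩ := hz.2 a ha
        obtain ⟨g₂, h5, h6⟩ := hg.1 d₁ h2
        have hra : b.image (e : Sinf) ⊆ d₁.image (g₂ : Sinf) := by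
          rw [← hr]
          intro k hk
          obtain ⟨i, hi, rfl⟩ := Finset.mem_image.1 hk
          exact Finset.mem_image.2 ⟨i, h2 hi, h5 i hi⟩
        obtain ⟨e₂, h7, b₂, h8, h9, h10⟩ := he.2 _ hra
        have hE := ihe g₂ e₂ d₁ b₂ h9.symm y h6 h10
        have hE' := BB_smul_eq G A hbasis x o (g₁ * g₂⁻¹) hE
        rw [inv_mul_cancel_right] at hE'
        rw [hE'] at h4
        refine ⟨_, ?_, b₂, h8, ?_, h4⟩
        · intro k hk
          rw [Subgroup.coe_mul, Equiv.Perm.mul_apply, h7 k hk]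
          refine hfixe _ ?_ k hk
          intro i hi
          have hinv : (g₂ : Sinf).symm ((g : Sinf) i) = i := by
            rw [← h5 i hi, Equiv.symm_apply_apply]
          simp [hinv, h1 i hi]
        · have : b₂.image ((g₁ * g₂⁻¹ * e₂ : G) : Sinf) =
              (b₂.image (e₂ : Sinf)).image ((g₁ * g₂⁻¹ : G) : Sinf) := by
            rw [Finset.image_image]; rfl
          rw [this, h9, Finset.image_image, ← h3]
          congr 1
          ext i; simp
  | limit o ho ih =>
    intro g e d b hr y hg he z hz
    rw [mem_BB_limit G A x _ o ho] at hg he hz ⊢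
    intro β hβ h1
    exact ih β hβ g e d b hr y (hg β hβ h1) (he β hβ h1) (hz β hβ h1)

theorem BB_eq_of_mem [ContinuousSMul G X] (A : ℕ → Set X)
    (hbasis : TopologicalSpace.IsTopologicalBasis (Set.range A)) (x : X) (α : Ordinal.{0})
    (g e : G) (d b : Finset ℕ) (hr : d.image (g : Sinf) = b.image (e : Sinf))
    (y : X) (hg : y ∈ BB G A x α g d) (he : y ∈ BB G A x α e b) :
    BB G A x α g d = BB G A x α e b :=
  (BB_subset_of_mem G A hbasis x α g e d b hr y hg he).antisymm
    (BB_subset_of_mem G A hbasis x α e g b d hr.symm y he hg)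

theorem BB_succ_subset (A : ℕ → Set X) (x : X) (α : Ordinal.{0}) (g : G) (d : Finset ℕ) :
    BB G A x (α + 1) g d ⊆ BB G A x α g d := by
  intro y hy
  by_cases hα : α = 0
  · subst hα; rw [BB_zero]; trivial
  · rw [mem_BB_succ G A x _ α hα] at hy
    obtain ⟨g', h1, h2⟩ := hy.1 d subset_rfl
    rwa [BB_congr G A x α h1] at h2

theorem BB_mono (A : ℕ → Set X) (x : X) (β : Ordinal.{0}) (g : G) (d : Finset ℕ) :
    ∀ α ≤ β, BB G A x β g d ⊆ BB G A x α g d := by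
  induction β using Ordinal.limitRecOn with
  | zero =>
    intro α hα
    rw [nonpos_iff_eq_zero.1 hα]
  | add_one o ih =>
    intro α hα
    rcases hα.eq_or_lt with rfl | h
    · exact subset_rfl
    · exact (BB_succ_subset G A x o g d).trans (ih α (Order.lt_add_one_iff.1 h))
  | limit o ho ih =>
    intro α hα
    rcases hα.eq_or_lt with rfl | h
    · exact subset_rfl
    · intro y hy
      by_cases h0 : α = 0
      · subst h0; rw [BB_zero]; trivial
      · exact (mem_BB_limit G A x _ o ho g d).1 hy α h (Order.one_le_iff_pos.2 (pos_iff_ne_zero.2 h0))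

theorem smul_mem_BB_self (A : ℕ → Set X)
    (hbasis : TopologicalSpace.IsTopologicalBasis (Set.range A)) (x : X) (α : Ordinal.{0}) :
    ∀ (g : G) (d : Finset ℕ), g • x ∈ BB G A x α g d := by
  induction α using Ordinal.limitRecOn with
  | zero => intro g d; rw [BB_zero]; trivial
  | add_one o ih =>
    intro g d
    by_cases ho : o = 0
    · subst ho
      rw [mem_BB_one G A hbasis]
      intro U hU
      constructor
      · rintro ⟨k, hk, h⟩
        refine ⟨k * g⁻¹, fun i hi => by simp [hk i hi], ?_⟩
        simpa [mul_smul] using h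
      · rintro ⟨k, hk, h⟩
        refine ⟨k * g, fun i hi => by simp [hk i hi], ?_⟩
        simpa [mul_smul] using h
    · rw [mem_BB_succ G A x _ o ho]
      refine ⟨fun b hb => ⟨g, fun _ _ => rfl, ih g b⟩, fun a ha => ?_⟩
      refine ⟨g, fun _ _ => rfl, a.image ((g⁻¹ : G) : Sinf), ?_, ?_, ih g _⟩
      · intro k hk
        exact Finset.mem_image.2 ⟨(g : Sinf) k, ha (Finset.mem_image_of_mem _ hk), by simp⟩
      · rw [Finset.image_image]
        refine (Finset.image_congr fun i _ => ?_).trans Finset.image_id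
        simp
  | limit o ho ih =>
    intro g d
    rw [mem_BB_limit G A x _ o ho]
    intro β hβ _
    exact ih β hβ g d

theorem SGfin_countable : (SGfin G).Countable := by
  refine (Set.Countable.setOf_finite (α := ℕ × ℕ)).mono ?_
  rintro _ ⟨g, _, d, rfl⟩
  refine (d.finite_toSet.image (fun k => (k, g k))).subset ?_
  rintro ⟨a, b⟩ ⟨h1, h2⟩
  exact ⟨a, h1, by simp only at h2; simp [h2]⟩

theorem gammaStar_spec [ContinuousSMul G X] (A : ℕ → Set X)
    (hbasis : TopologicalSpace.IsTopologicalBasis (Set.range A)) (x : X) :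
    gammaStar G A x ∈ {γ : Ordinal.{0} | γ.card ≤ Cardinal.aleph0 ∧
    ∀ σ ∈ SGfin G, ∀ δ ∈ SGfin G, prng σ = prng δ →
      (∃ α : Ordinal.{0}, 1 ≤ α ∧ α.card ≤ Cardinal.aleph0 ∧
        Bset G A α σ x ≠ Bset G A α δ x) →
      Bset G A γ σ x ≠ Bset G A γ δ x} := by
  unfold gammaStar
  apply csInf_mem
  haveI : Countable (SGfin G) := (SGfin_countable G).to_subtype
  have hch : ∀ p : SGfin G × SGfin G, ∃ β : Ordinal.{0}, β.card ≤ Cardinal.aleph0 ∧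
      ((∃ α : Ordinal.{0}, 1 ≤ α ∧ α.card ≤ Cardinal.aleph0 ∧
        Bset G A α p.1 x ≠ Bset G A α p.2 x) → Bset G A β p.1 x ≠ Bset G A β p.2 x) := by
    intro p
    by_cases h : ∃ α : Ordinal.{0}, 1 ≤ α ∧ α.card ≤ Cardinal.aleph0 ∧
        Bset G A α p.1 x ≠ Bset G A α p.2 x
    · obtain ⟨α, h1, h2, h3⟩ := h
      exact ⟨α, h2, fun _ => h3⟩
    · exact ⟨0, by simp, fun h' => absurd h' h⟩
  choose f hf1 hf2 using hch
  refine ⟨⨆ p, f p, ?_, ?_⟩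
  · exact Ordinal.card_iSup_le (Cardinal.mk_le_aleph0) hf1
  · intro σ hσ δ hδ hr hex heq
    refine hf2 (⟨σ, hσ⟩, ⟨δ, hδ⟩) hex ?_
    have hle := Ordinal.le_iSup f (⟨σ, hσ⟩, ⟨δ, hδ⟩)
    obtain ⟨g, hg, d, rfl⟩ := hσ
    obtain ⟨e, he, b, rfl⟩ := hδ
    have hy := smul_mem_BB_self G A hbasis x (⨆ p, f p) ⟨g, hg⟩ d
    have hy' : (⟨g, hg⟩ : G) • x ∈ BB G A x (⨆ p, f p) ⟨e, he⟩ b := by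
      unfold BB at hy ⊢
      exact heq ▸ hy
    rw [prng_restr, prng_restr, Finset.coe_inj] at hr
    exact BB_eq_of_mem G A hbasis x _ ⟨g, hg⟩ ⟨e, he⟩ d b hr _
      (BB_mono G A x _ _ _ _ hle hy) (BB_mono G A x _ _ _ _ hle hy')

theorem gammaStar_step [ContinuousSMul G X] (A : ℕ → Set X)
    (hbasis : TopologicalSpace.IsTopologicalBasis (Set.range A)) (x : X)
    (g e : G) (d b : Finset ℕ) (hr : d.image (g : Sinf) = b.image (e : Sinf))
    (h : BB G A x (gammaStar G A x) g d = BB G A x (gammaStar G A x) e b) :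
    BB G A x (gammaStar G A x + 1) g d = BB G A x (gammaStar G A x + 1) e b := by
  obtain ⟨h1, h2⟩ := gammaStar_spec G A hbasis x
  by_contra hne
  refine h2 _ ⟨g, g.2, d, rfl⟩ _ ⟨e, e.2, b, rfl⟩ ?_ ⟨gammaStar G A x + 1, ?_, ?_, hne⟩ h
  · rw [prng_restr, prng_restr, hr]
  · simp
  · rw [Ordinal.card_add]
    exact (add_le_add h1 (by simp : (1 : Ordinal.{0}).card ≤ Cardinal.aleph0)).trans (by simp)

theorem mem_orb [ContinuousSMul G X] (A : ℕ → Set X)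
    (hbasis : TopologicalSpace.IsTopologicalBasis (Set.range A)) (x y : X)
    (g : G) (d : Finset ℕ) (hy : y ∈ BB G A x (gammaStar G A x + 1 + 1) g d) :
    ∀ (n : ℕ) (g₁ : G) (d₁ : Finset ℕ), d ⊆ d₁ → (∀ k ∈ d, (g₁ : Sinf) k = (g : Sinf) k) →
      y ∈ BB G A x (gammaStar G A x + 1) g₁ d₁ →
      ∃ (g₂ : G) (d₂ : Finset ℕ), d₁ ⊆ d₂ ∧ (∀ k ∈ d₁, (g₂ : Sinf) k = (g₁ : Sinf) k) ∧
        n ∈ d₂ ∧ n ∈ d₂.image (g₂ : Sinf) ∧ y ∈ BB G A x (gammaStar G A x + 1) g₂ d₂ := by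
  set γ := gammaStar G A x with hγ
  -- every relevant `γ`-membership upgrades to `γ + 1`
  have up : ∀ (g₂ : G) (d₂ : Finset ℕ), d ⊆ d₂ → (∀ k ∈ d, (g₂ : Sinf) k = (g : Sinf) k) →
      y ∈ BB G A x γ g₂ d₂ → y ∈ BB G A x (γ + 1) g₂ d₂ := by
    intro g₂ d₂ hd hag hy2
    have hsub : d.image (g : Sinf) ⊆ d₂.image (g₂ : Sinf) := by
      intro k hk
      obtain ⟨i, hi, rfl⟩ := Finset.mem_image.1 hk
      exact Finset.mem_image.2 ⟨i, hd hi, hag i hi⟩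
    rw [mem_BB_succ G A x _ (γ + 1) (by simp)] at hy
    obtain ⟨e, h1, b, h2, h3, h4⟩ := hy.2 _ hsub
    have h5 := BB_eq_of_mem G A hbasis x γ e g₂ b d₂ h3 y (BB_succ_subset G A x γ e b h4) hy2
    rw [← gammaStar_step G A hbasis x e g₂ b d₂ h3 h5]
    exact h4
  have forth : ∀ (g₁ : G) (d₁ b : Finset ℕ), d₁ ⊆ b → y ∈ BB G A x (γ + 1) g₁ d₁ →
      ∃ g₂ : G, (∀ k ∈ d₁, (g₂ : Sinf) k = (g₁ : Sinf) k) ∧ y ∈ BB G A x γ g₂ b := by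
    intro g₁ d₁ b hb h
    by_cases h0 : γ = 0
    · exact ⟨g₁, fun _ _ => rfl, by rw [h0, BB_zero]; trivial⟩
    · exact ((mem_BB_succ G A x y γ h0 g₁ d₁).1 h).1 b hb
  have back : ∀ (g₁ : G) (d₁ : Finset ℕ) (n : ℕ), y ∈ BB G A x (γ + 1) g₁ d₁ →
      ∃ g₂ : G, (∀ k ∈ d₁, (g₂ : Sinf) k = (g₁ : Sinf) k) ∧ ∃ d₂ : Finset ℕ, d₁ ⊆ d₂ ∧
        n ∈ d₂.image (g₂ : Sinf) ∧ y ∈ BB G A x γ g₂ d₂ := by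
    intro g₁ d₁ n h
    by_cases h0 : γ = 0
    · refine ⟨g₁, fun _ _ => rfl, insert (((g₁⁻¹ : G) : Sinf) n) d₁,
        Finset.subset_insert _ _, ?_, by rw [h0, BB_zero]; trivial⟩
      exact Finset.mem_image.2 ⟨_, Finset.mem_insert_self _ _, by simp⟩
    · obtain ⟨g₂, h1, d₂, h2, h3, h4⟩ := ((mem_BB_succ G A x y γ h0 g₁ d₁).1 h).2
        (insert n (d₁.image (g₁ : Sinf))) (Finset.subset_insert _ _)
      exact ⟨g₂, h1, d₂, h2, by rw [h3]; exact Finset.mem_insert_self _ _, h4⟩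
  intro n g₁ d₁ hd hag h
  obtain ⟨g₂, h1, h2⟩ := forth g₁ d₁ (insert n d₁) (Finset.subset_insert _ _) h
  have hd2 : d ⊆ insert n d₁ := hd.trans (Finset.subset_insert _ _)
  have hag2 : ∀ k ∈ d, (g₂ : Sinf) k = (g : Sinf) k := fun k hk => by
    rw [h1 k (hd hk), hag k hk]
  have h3 := up g₂ _ hd2 hag2 h2
  obtain ⟨g₃, h4, d₃, h5, h6, h7⟩ := back g₂ _ n h3
  refine ⟨g₃, d₃, (Finset.subset_insert _ _).trans h5, ?_, h5 (Finset.mem_insert_self _ _), h6,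
    up g₃ d₃ (hd2.trans h5) ?_ h7⟩
  · intro k hk
    rw [h4 k (Finset.mem_insert_of_mem hk), h1 k hk]
  · intro k hk
    rw [h4 k (hd2 hk), hag2 k hk]

theorem exists_limit (hGclosed : IsClosed (G : Set Sinf)) (g : ℕ → G) (d : ℕ → Finset ℕ)
    (hd : ∀ n, d n ⊆ d (n + 1))
    (hg : ∀ n, ∀ k ∈ d n, (g (n + 1) : Sinf) k = (g n : Sinf) k)
    (h1 : ∀ n, n ∈ d (n + 1)) (h2 : ∀ n, n ∈ (d (n + 1)).image (g (n + 1) : Sinf)) :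
    ∃ f : G, ∀ n, ∀ k ∈ d n, (f : Sinf) k = (g n : Sinf) k := by
  have hdm : Monotone d := monotone_nat_of_le_succ hd
  have hgm : ∀ n m, n ≤ m → ∀ k ∈ d n, (g m : Sinf) k = (g n : Sinf) k := by
    intro n m hnm
    induction m, hnm using Nat.le_induction with
    | base => intro k _; rfl
    | succ m hnm ih => intro k hk; rw [hg m k (hdm hnm hk), ih k hk]
  let F : ℕ → ℕ := fun k => (g (k + 1) : Sinf) k
  have hF : ∀ n, ∀ k ∈ d n, F k = (g n : Sinf) k := by
    intro n k hk
    rcases le_total n (k + 1) with h | h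
    · exact hgm n (k + 1) h k hk
    · exact (hgm (k + 1) n h k (h1 k)).symm
  have hinj : Function.Injective F := by
    intro i j hij
    have hi : F i = (g (max i j + 1) : Sinf) i := hF _ i (hdm (by omega) (h1 i))
    have hj : F j = (g (max i j + 1) : Sinf) j := hF _ j (hdm (by omega) (h1 j))
    exact (g (max i j + 1) : Sinf).injective (by rw [← hi, ← hj, hij])
  have hsurj : Function.Surjective F := by
    intro n
    obtain ⟨k, hk, hk'⟩ := Finset.mem_image.1 (h2 n)
    exact ⟨k, by rw [hF _ k hk, hk']⟩
  let f : Sinf := Equiv.ofBijective F ⟨hinj, hsurj⟩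
  have hf : f ∈ G := by
    have ht : Filter.Tendsto (fun n => (g n : Sinf)) Filter.atTop (nhds f) := by
      rw [nhds_induced, Filter.tendsto_comap_iff, tendsto_pi_nhds]
      intro k
      refine tendsto_const_nhds.congr' ?_
      filter_upwards [Filter.eventually_ge_atTop (k + 1)] with n hn
      exact hF n k (hdm hn (h1 k))
    exact hGclosed.mem_of_tendsto ht (Filter.Eventually.of_forall fun n => (g n).2)
  exact ⟨⟨f, hf⟩, hF⟩

theorem BB_eq_orb (hGclosed : IsClosed (G : Set Sinf)) [T2Space X] [ContinuousSMul G X]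
    (A : ℕ → Set X) (hbasis : TopologicalSpace.IsTopologicalBasis (Set.range A))
    (hbasisInv : ∀ l, ∃ c : Finset ℕ, ∀ g ∈ Vc G (↑c : Set ℕ), g • A l = A l)
    (x : X) (g : G) (d : Finset ℕ) :
    BB G A x (gammaStar G A x + 2) g d = setOrb G (Vb G (restr g d)) x := by
  have h2 : gammaStar G A x + 2 = gammaStar G A x + 1 + 1 := by
    rw [add_assoc, one_add_one_eq_two]
  rw [h2]
  apply Subset.antisymm
  · intro y hy
    have step := mem_orb G A hbasis x y g d hy
    let S := {p : G × Finset ℕ // d ⊆ p.2 ∧ (∀ k ∈ d, (p.1 : Sinf) k = (g : Sinf) k) ∧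
      y ∈ BB G A x (gammaStar G A x + 1) p.1 p.2}
    have step' : ∀ (n : ℕ) (p : S), ∃ q : S, p.1.2 ⊆ q.1.2 ∧
        (∀ k ∈ p.1.2, (q.1.1 : Sinf) k = (p.1.1 : Sinf) k) ∧ n ∈ q.1.2 ∧
        n ∈ q.1.2.image (q.1.1 : Sinf) := by
      rintro n ⟨⟨g₁, d₁⟩, ha, hb, hc⟩
      obtain ⟨g₂, d₂, k1, k2, k3, k4, k5⟩ := step n g₁ d₁ ha hb hc
      exact ⟨⟨⟨g₂, d₂⟩, ha.trans k1, fun k hk => by rw [← hb k hk]; exact k2 k (ha hk), k5⟩,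
        k1, k2, k3, k4⟩
    choose nxt hn using step'
    let p : ℕ → S := fun n => Nat.rec (motive := fun _ => S)
      ⟨(g, d), subset_rfl, fun _ _ => rfl, BB_succ_subset G A x _ g d hy⟩
      (fun n q => nxt n q) n
    have hp : ∀ n, p (n + 1) = nxt n (p n) := fun n => rfl
    obtain ⟨f, hf⟩ := exists_limit G hGclosed (fun n => (p n).1.1) (fun n => (p n).1.2)
      (fun n => (hn n (p n)).1) (fun n => (hn n (p n)).2.1) (fun n => (hn n (p n)).2.2.1)
      (fun n => (hn n (p n)).2.2.2)
    refine ⟨f, (mem_Vb_restr G g f d).2 (hf 0), ?_⟩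
    by_contra hne
    have hne' : f • x ≠ y := hne
    have hopen : IsOpen ({y}ᶜ : Set X) := isOpen_compl_singleton
    obtain ⟨_, ⟨l, rfl⟩, m1, m2⟩ := hbasis.exists_subset_of_mem_open
      (show f • x ∈ ({y}ᶜ : Set X) from hne') hopen
    obtain ⟨c, hc⟩ := hbasisInv l
    -- a stage whose range covers `c`
    obtain ⟨N, hN⟩ : ∃ N, ∀ k ∈ c, k < N := ⟨c.sup id + 1, fun k hk =>
      Nat.lt_succ_of_le (Finset.le_sup (f := id) hk)⟩
    have hdm : Monotone (fun n => (p n).1.2) := monotone_nat_of_le_succ fun n => (hn n (p n)).1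
    have hcN : ∀ k ∈ c, ∃ i ∈ (p N).1.2, ((p N).1.1 : Sinf) i = k := by
      intro k hk
      obtain ⟨i, hi, hi'⟩ := Finset.mem_image.1 (hn k (p k)).2.2.2
      have hi2 : i ∈ (p N).1.2 := hdm (show k + 1 ≤ N from hN k hk) hi
      refine ⟨i, hi2, ?_⟩
      rw [← hf N i hi2, ← hi']
      exact hf (k + 1) i hi
    have hy1 := BB_mono G A x _ _ _ (0 + 1) (by simp) (p N).2.2.2
    rw [mem_BB_one G A hbasis] at hy1
    obtain ⟨k, hk, hky⟩ := (hy1 (A l) (hbasis.isOpen ⟨l, rfl⟩)).1 ⟨f, hf N, m1⟩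
    have hkc : k ∈ Vc G (↑c : Set ℕ) := by
      intro j hj
      obtain ⟨i, hi, rfl⟩ := hcN j hj
      exact hk i hi
    have : y ∈ A l := by
      rw [← hc k hkc] at hky
      exact (Set.smul_mem_smul_set_iff).1 hky
    exact m2 this rfl
  · rintro _ ⟨f, hf, rfl⟩
    rw [← BB_congr G A x _ ((mem_Vb_restr G g f d).1 hf)]
    exact smul_mem_BB_self G A hbasis x _ f d

end Helpers

/-- The orbit is the `(γ*+2)`-set. -/
theorem orbit_eq_gammaStar_plus_two_set
    (G : Subgroup Sinf) (hGclosed : IsClosed (G : Set Sinf))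
    {X : Type*} [TopologicalSpace X] [PolishSpace X] [MulAction G X] [ContinuousSMul G X]
    (A : ℕ → Set X) (hbasis : TopologicalSpace.IsTopologicalBasis (Set.range A))
    (hbasisInv : ∀ l, ∃ c : Finset ℕ, ∀ g ∈ Vc G (↑c : Set ℕ), g • A l = A l)
    (x : X) :
    Bset G A (gammaStar G A x + 2) (∅ : Set (ℕ × ℕ)) x = MulAction.orbit G x ∧
    ∀ σ ∈ SGfin G, Bset G A (gammaStar G A x + 2) σ x = setOrb G (Vb G σ) x := by

  have main : ∀ σ ∈ SGfin G, Bset G A (gammaStar G A x + 2) σ x = setOrb G (Vb G σ) x := by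
    rintro _ ⟨g, hg, d, rfl⟩
    exact BB_eq_orb G hGclosed A hbasis hbasisInv x ⟨g, hg⟩ d
  refine ⟨?_, main⟩
  rw [main ∅ ⟨1, G.one_mem, ∅, by ext; simp [restr]⟩]
  ext y
  simp [setOrb, Vb, MulAction.mem_orbit_iff]
end
end
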